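/- Let n be an integer with 5 ≤ n ≤ 8. Then for every p > 1 there is no stable classical solution of the biharmonic equation Δ²u = u^p, u > 0, on ℝⁿ. -/

import Mathlib

open MeasureTheory Real RealInnerProductSpace

/-- The Laplacian of `f : ℝⁿ → ℝ`, as the trace of the second derivative. -/
noncomputable def lap {n : ℕ} (f : EuclideanSpace ℝ (Fin n) → ℝ)
    (x : EuclideanSpace ℝ (Fin n)) : ℝ :=
  ∑ i : Fin n,
    iteratedFDeriv ℝ 2 f x ![EuclideanSpace.single i 1, EuclideanSpace.single i 1]

/-- Squared Frobenius norm of the Hessian of `f : ℝⁿ → ℝ`. -/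
noncomputable def hessNormSq {n : ℕ} (f : EuclideanSpace ℝ (Fin n) → ℝ)
    (x : EuclideanSpace ℝ (Fin n)) : ℝ :=
  ∑ i : Fin n, ∑ j : Fin n,
    (iteratedFDeriv ℝ 2 f x ![EuclideanSpace.single i 1, EuclideanSpace.single j 1]) ^ 2

/-- The quantity `‖∇⁴(φ^{2γ})‖` defined by
`‖∇⁴(φ^{2γ})‖² = φ^{-2γ}|∇φ^γ|⁴ + |φ^γ Δ²φ^γ| + |∇²φ^γ|²`,
with the first term interpreted as `0` where `φ = 0`. -/
noncomputable def norm4 {n : ℕ} (γ : ℝ) (φ : EuclideanSpace ℝ (Fin n) → ℝ)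
    (x : EuclideanSpace ℝ (Fin n)) : ℝ :=
  Real.sqrt
    ((if φ x = 0 then 0 else φ x ^ (-(2*γ)) * ‖gradient (fun y => φ y ^ γ) x‖ ^ 4)
      + |φ x ^ γ * lap (lap (fun y => φ y ^ γ)) x|
      + hessNormSq (fun y => φ y ^ γ) x)

namespace Biharmonic

open Filter Topology

variable {n : ℕ}

/-- The `i`-th partial derivative of a function on `ℝⁿ`. -/
noncomputable def partialDeriv (i : Fin n) (f : EuclideanSpace ℝ (Fin n) → ℝ)
    (x : EuclideanSpace ℝ (Fin n)) : ℝ :=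
  fderiv ℝ f x (EuclideanSpace.single i 1)

/-- The pointwise inner product of the gradients of two functions on `ℝⁿ`. -/
noncomputable def gradDot (f g : EuclideanSpace ℝ (Fin n) → ℝ)
    (x : EuclideanSpace ℝ (Fin n)) : ℝ :=
  ∑ i, partialDeriv i f x * partialDeriv i g x

variable {f g h : EuclideanSpace ℝ (Fin n) → ℝ}

lemma contDiff_partialDeriv {k m : WithTop ℕ∞} (hf : ContDiff ℝ m f) (hk : k + 1 ≤ m) (i : Fin n) :
    ContDiff ℝ k (partialDeriv i f) :=
  (hf.fderiv_right hk).clm_apply contDiff_const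

lemma lap_eq_sum (hf : ContDiff ℝ 2 f) : lap f = fun x => ∑ i, partialDeriv i (partialDeriv i f) x := by
  funext x
  unfold lap
  refine Finset.sum_congr rfl fun i _ => ?_
  rw [iteratedFDeriv_two_apply]
  have h1 : DifferentiableAt ℝ (fderiv ℝ f) x :=
    (hf.fderiv_right (m := 1) (by norm_num)).differentiable (by norm_num) x
  simp only [Matrix.cons_val_zero, Matrix.cons_val_one]
  change _ = fderiv ℝ (fun y => fderiv ℝ f y (EuclideanSpace.single i 1)) x _
  rw [fderiv_clm_apply h1 (differentiableAt_const _)]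
  simp

lemma contDiff_lap {k m : WithTop ℕ∞} (hf : ContDiff ℝ m f) (hk : k + 2 ≤ m) :
    ContDiff ℝ k (lap f) := by
  have h2 : ContDiff ℝ 2 f := hf.of_le (le_trans (by simp) hk)
  rw [lap_eq_sum h2]
  refine ContDiff.sum fun i _ => ?_
  refine contDiff_partialDeriv (contDiff_partialDeriv hf (k := k + 1) ?_ i) le_rfl i
  rw [add_assoc]
  exact le_trans (by norm_num) hk

lemma continuous_lap (hf : ContDiff ℝ 2 f) : Continuous (lap f) :=
  (contDiff_lap (k := 0) hf (by norm_num)).continuous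

lemma contDiff_gradDot {k m : WithTop ℕ∞} (hf : ContDiff ℝ m f) (hg : ContDiff ℝ m g)
    (hk : k + 1 ≤ m) : ContDiff ℝ k (gradDot f g) :=
  ContDiff.sum fun i _ => (contDiff_partialDeriv hf hk i).mul (contDiff_partialDeriv hg hk i)

lemma continuous_gradDot (hf : ContDiff ℝ 1 f) (hg : ContDiff ℝ 1 g) :
    Continuous (gradDot f g) :=
  (contDiff_gradDot (k := 0) hf hg (by norm_num)).continuous

lemma gradDot_comm : gradDot f g = gradDot g f := by
  funext x
  simp only [gradDot, mul_comm]

lemma gradDot_self_nonneg (x : EuclideanSpace ℝ (Fin n)) : 0 ≤ gradDot f f x :=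
  Finset.sum_nonneg fun _ _ => mul_self_nonneg _

lemma gradDot_sq_le (x : EuclideanSpace ℝ (Fin n)) :
    gradDot f g x ^ 2 ≤ gradDot f f x * gradDot g g x := by
  have := Finset.sum_mul_sq_le_sq_mul_sq Finset.univ (fun i => partialDeriv i f x)
    (fun i => partialDeriv i g x)
  simpa only [gradDot, ← sq] using this

lemma partialDeriv_add (hf : Differentiable ℝ f) (hg : Differentiable ℝ g) (i : Fin n) :
    partialDeriv i (fun x => f x + g x) = fun x => partialDeriv i f x + partialDeriv i g x := by
  funext x
  simp only [partialDeriv, fderiv_fun_add (hf x) (hg x)]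
  rfl

lemma partialDeriv_mul (hf : Differentiable ℝ f) (hg : Differentiable ℝ g) (i : Fin n) :
    partialDeriv i (fun x => f x * g x) =
      fun x => f x * partialDeriv i g x + partialDeriv i f x * g x := by
  funext x
  simp only [partialDeriv, fderiv_fun_mul (hf x) (hg x)]
  simp [mul_comm]

lemma lap_add (hf : ContDiff ℝ 2 f) (hg : ContDiff ℝ 2 g) (x : EuclideanSpace ℝ (Fin n)) :
    lap (fun x => f x + g x) x = lap f x + lap g x := by
  rw [lap_eq_sum hf, lap_eq_sum hg, lap_eq_sum (hf.add hg), ← Finset.sum_add_distrib]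
  refine Finset.sum_congr rfl fun i _ => ?_
  rw [partialDeriv_add (hf.differentiable (by norm_num)) (hg.differentiable (by norm_num)),
    partialDeriv_add ((contDiff_partialDeriv (k := 1) hf (by norm_num) i).differentiable (by norm_num))
      ((contDiff_partialDeriv (k := 1) hg (by norm_num) i).differentiable (by norm_num))]

lemma lap_mul (hf : ContDiff ℝ 2 f) (hg : ContDiff ℝ 2 g) (x : EuclideanSpace ℝ (Fin n)) :
    lap (fun x => f x * g x) x = f x * lap g x + 2 * gradDot f g x + g x * lap f x := by
  have hf' : Differentiable ℝ f := hf.differentiable (by norm_num)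
  have hg' : Differentiable ℝ g := hg.differentiable (by norm_num)
  have hfd := fun i => (contDiff_partialDeriv (k := 1) hf (by norm_num) i).differentiable
    (by norm_num)
  have hgd := fun i => (contDiff_partialDeriv (k := 1) hg (by norm_num) i).differentiable
    (by norm_num)
  rw [lap_eq_sum hf, lap_eq_sum hg, lap_eq_sum (hf.mul hg)]
  simp only [gradDot, Finset.mul_sum, ← Finset.sum_add_distrib]
  refine Finset.sum_congr rfl fun i _ => ?_
  rw [partialDeriv_mul hf' hg', partialDeriv_add (hf'.fun_mul (hgd i)) ((hfd i).fun_mul hg'),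
    partialDeriv_mul hf' (hgd i), partialDeriv_mul (hfd i) hg']
  ring

lemma gradDot_mul_left (hf : Differentiable ℝ f) (hg : Differentiable ℝ g)
    (x : EuclideanSpace ℝ (Fin n)) :
    gradDot (fun x => f x * g x) h x = f x * gradDot g h x + g x * gradDot f h x := by
  simp only [gradDot, Finset.mul_sum, ← Finset.sum_add_distrib]
  refine Finset.sum_congr rfl fun i _ => ?_
  rw [partialDeriv_mul hf hg]
  ring

lemma partialDeriv_comp {F F' : ℝ → ℝ} (hf : Differentiable ℝ f)
    (hF : ∀ x, HasDerivAt F (F' (f x)) (f x)) (i : Fin n) :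
    partialDeriv i (fun x => F (f x)) = fun x => F' (f x) * partialDeriv i f x := by
  funext x
  have := ((hF x).comp_hasFDerivAt x (hf x).hasFDerivAt).fderiv
  simp only [partialDeriv]
  change fderiv ℝ (F ∘ f) x _ = _
  rw [this]
  simp

lemma gradDot_pow (hf : Differentiable ℝ f) (m : ℕ) (x : EuclideanSpace ℝ (Fin n)) :
    gradDot (fun x => f x ^ (m + 1)) g x = (m + 1) * f x ^ m * gradDot f g x := by
  simp only [gradDot, Finset.mul_sum]
  refine Finset.sum_congr rfl fun i _ => ?_
  rw [partialDeriv_comp (F := fun t => t ^ (m + 1)) (F' := fun t => (m + 1 : ℝ) * t ^ m) hf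
    (fun y => by simpa using hasDerivAt_pow (m + 1) (f y))]
  ring

lemma lap_rpow (hf : ContDiff ℝ 2 f) (hpos : ∀ x, 0 < f x) (p : ℝ)
    (x : EuclideanSpace ℝ (Fin n)) :
    lap (fun x => f x ^ p) x =
      p * f x ^ (p - 1) * lap f x + p * (p - 1) * f x ^ (p - 2) * gradDot f f x := by
  have hf' : Differentiable ℝ f := hf.differentiable (by norm_num)
  have hfd := fun i => (contDiff_partialDeriv (k := 1) hf (by norm_num) i).differentiable
    (by norm_num)
  have hr : ∀ q : ℝ, ContDiff ℝ 2 fun x => f x ^ q := fun q =>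
    hf.rpow_const_of_ne fun x => (hpos x).ne'
  have hd : ∀ (q : ℝ) (i : Fin n), partialDeriv i (fun x => f x ^ q) =
      fun x => (q * f x ^ (q - 1)) * partialDeriv i f x := fun q i =>
    partialDeriv_comp (F := fun t => t ^ q) (F' := fun t => q * t ^ (q - 1)) hf'
      (fun y => Real.hasDerivAt_rpow_const (Or.inl (hpos y).ne')) i
  have hd2 : ∀ (q : ℝ) (i : Fin n), partialDeriv i (fun x => q * f x ^ (q - 1)) =
      fun x => (q * ((q - 1) * f x ^ (q - 2))) * partialDeriv i f x := fun q i =>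
    partialDeriv_comp (F := fun t => q * t ^ (q - 1)) (F' := fun t => q * ((q - 1) * t ^ (q - 2)))
      hf' (fun y => by
        have := (Real.hasDerivAt_rpow_const (p := q - 1) (Or.inl (hpos y).ne')).const_mul q
        rwa [show q - 1 - 1 = q - 2 by ring] at this) i
  rw [lap_eq_sum hf, lap_eq_sum (hr p)]
  simp only [gradDot, Finset.mul_sum, ← Finset.sum_add_distrib]
  refine Finset.sum_congr rfl fun i _ => ?_
  rw [hd, partialDeriv_mul (((hr (p - 1)).differentiable (by norm_num)).const_mul p) (hfd i), hd2]
  ring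

lemma lap_congr {x : EuclideanSpace ℝ (Fin n)} (hfg : f =ᶠ[𝓝 x] g) : lap f x = lap g x := by
  unfold lap
  rw [hfg.iteratedFDeriv ℝ 2 |>.eq_of_nhds]

lemma partialDeriv_congr {x : EuclideanSpace ℝ (Fin n)} (hfg : f =ᶠ[𝓝 x] g) (i : Fin n) :
    partialDeriv i f x = partialDeriv i g x := by
  unfold partialDeriv
  rw [hfg.fderiv_eq]

lemma lap_const (c : ℝ) (x : EuclideanSpace ℝ (Fin n)) : lap (fun _ => c) x = 0 := by
  unfold lap
  rw [iteratedFDeriv_const_of_ne (by norm_num)]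
  simp

lemma partialDeriv_const_mul (hf : Differentiable ℝ f) (c : ℝ) (i : Fin n) :
    partialDeriv i (fun x => c * f x) = fun x => c * partialDeriv i f x := by
  funext x
  simp only [partialDeriv, fderiv_const_mul (hf x)]
  rfl

lemma gradDot_const_mul_self (hf : Differentiable ℝ f) (c : ℝ) (x : EuclideanSpace ℝ (Fin n)) :
    gradDot (fun x => c * f x) (fun x => c * f x) x = c ^ 2 * gradDot f f x := by
  simp only [gradDot, Finset.mul_sum, partialDeriv_const_mul hf]
  exact Finset.sum_congr rfl fun i _ => by ring

lemma lap_const_mul (hf : ContDiff ℝ 2 f) (c : ℝ) :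
    lap (fun x => c * f x) = fun x => c * lap f x := by
  have hfd := fun i => (contDiff_partialDeriv (k := 1) hf (by norm_num) i).differentiable
    (by norm_num)
  rw [lap_eq_sum hf, lap_eq_sum (contDiff_const.mul hf)]
  funext x
  rw [Finset.mul_sum]
  refine Finset.sum_congr rfl fun i _ => ?_
  rw [partialDeriv_const_mul (hf.differentiable (by norm_num)), partialDeriv_const_mul (hfd i)]

lemma partialDeriv_comp_affine (hf : Differentiable ℝ f) (x₀ : EuclideanSpace ℝ (Fin n)) (R : ℝ)
    (i : Fin n) :
    partialDeriv i (fun y => f (x₀ + R • y)) = fun x => R * partialDeriv i f (x₀ + R • x) := by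
  funext x
  have h1 : HasFDerivAt (fun y : EuclideanSpace ℝ (Fin n) => x₀ + R • y)
      (R • ContinuousLinearMap.id ℝ _) x :=
    ((hasFDerivAt_id x).const_smul R).const_add x₀
  have := ((hf (x₀ + R • x)).hasFDerivAt.comp x h1).fderiv
  simp only [partialDeriv]
  change fderiv ℝ (f ∘ _) x _ = _
  rw [this]
  simp

lemma contDiff_comp_affine {m : WithTop ℕ∞} (hf : ContDiff ℝ m f) (x₀ : EuclideanSpace ℝ (Fin n))
    (R : ℝ) : ContDiff ℝ m fun y => f (x₀ + R • y) :=
  hf.comp (contDiff_const.add (contDiff_id.const_smul R))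

lemma gradDot_comp_affine_self (hf : Differentiable ℝ f) (x₀ x : EuclideanSpace ℝ (Fin n)) (R : ℝ) :
    gradDot (fun y => f (x₀ + R • y)) (fun y => f (x₀ + R • y)) x =
      R ^ 2 * gradDot f f (x₀ + R • x) := by
  simp only [gradDot, Finset.mul_sum, partialDeriv_comp_affine hf]
  exact Finset.sum_congr rfl fun i _ => by ring

lemma lap_comp_affine (hf : ContDiff ℝ 2 f) (x₀ : EuclideanSpace ℝ (Fin n)) (R : ℝ) :
    lap (fun y => f (x₀ + R • y)) = fun x => R ^ 2 * lap f (x₀ + R • x) := by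
  have hfd := fun i => contDiff_partialDeriv (k := 1) hf (by norm_num) i
  have hfd' := fun i => (hfd i).differentiable (by norm_num)
  rw [lap_eq_sum hf, lap_eq_sum (contDiff_comp_affine hf x₀ R)]
  funext x
  rw [Finset.mul_sum]
  refine Finset.sum_congr rfl fun i _ => ?_
  rw [partialDeriv_comp_affine (hf.differentiable (by norm_num)),
    partialDeriv_const_mul ((contDiff_comp_affine (hfd i) x₀ R).differentiable (by norm_num)),
    partialDeriv_comp_affine (hfd' i)]
  ring

lemma lap_eq_zero_of_notMem_tsupport {x : EuclideanSpace ℝ (Fin n)} (hx : x ∉ tsupport f) :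
    lap f x = 0 := by
  rw [lap_congr (notMem_tsupport_iff_eventuallyEq.1 hx)]
  exact lap_const 0 x

lemma partialDeriv_eq_zero_of_notMem_tsupport {x : EuclideanSpace ℝ (Fin n)} (hx : x ∉ tsupport f)
    (i : Fin n) : partialDeriv i f x = 0 := by
  rw [partialDeriv_congr (notMem_tsupport_iff_eventuallyEq.1 hx)]
  simp [partialDeriv]

lemma gradDot_eq_zero_of_notMem_tsupport {x : EuclideanSpace ℝ (Fin n)} (hx : x ∉ tsupport g) :
    gradDot f g x = 0 := by
  simp [gradDot, partialDeriv_eq_zero_of_notMem_tsupport hx]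

lemma hasCompactSupport_partialDeriv (hf : HasCompactSupport f) (i : Fin n) :
    HasCompactSupport (partialDeriv i f) :=
  HasCompactSupport.intro hf fun _ hx => partialDeriv_eq_zero_of_notMem_tsupport hx i

lemma hasCompactSupport_lap (hf : HasCompactSupport f) : HasCompactSupport (lap f) :=
  HasCompactSupport.intro hf fun _ hx => lap_eq_zero_of_notMem_tsupport hx

lemma contDiff_of_smooth (hf : ContDiff ℝ (⊤ : ℕ∞) f) (m : ℕ) : ContDiff ℝ m f :=
  contDiff_infty.1 hf m

/-- Green's first identity. -/
lemma integral_gradDot (hf : ContDiff ℝ 1 f) (hg : ContDiff ℝ 2 g)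
    (hc : HasCompactSupport f ∨ HasCompactSupport g) :
    ∫ x, gradDot f g x = -∫ x, f x * lap g x := by
  have hfd := fun i => contDiff_partialDeriv (k := 0) hf (by norm_num) i
  have hgd := fun i => contDiff_partialDeriv (k := 1) hg (by norm_num) i
  have hgdd := fun i => contDiff_partialDeriv (k := 0) (hgd i) (by norm_num) i
  have h1 : ∀ i, Integrable fun x => partialDeriv i f x * partialDeriv i g x := fun i => by
    refine ((hfd i).continuous.mul (hgd i).continuous).integrable_of_hasCompactSupport ?_
    rcases hc with hc | hc
    · exact (hasCompactSupport_partialDeriv hc i).mul_right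
    · exact (hasCompactSupport_partialDeriv hc i).mul_left
  have h2 : ∀ i, Integrable fun x => f x * partialDeriv i (partialDeriv i g) x := fun i => by
    refine (hf.continuous.mul (hgdd i).continuous).integrable_of_hasCompactSupport ?_
    rcases hc with hc | hc
    · exact hc.mul_right
    · exact (hasCompactSupport_partialDeriv (hasCompactSupport_partialDeriv hc i) i).mul_left
  have h3 : ∀ i, Integrable fun x => f x * partialDeriv i g x := fun i => by
    refine (hf.continuous.mul (hgd i).continuous).integrable_of_hasCompactSupport ?_
    rcases hc with hc | hc
    · exact hc.mul_right
    · exact (hasCompactSupport_partialDeriv hc i).mul_left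
  simp only [lap_eq_sum hg, gradDot, Finset.mul_sum]
  rw [integral_finsetSum _ fun i _ => h1 i, integral_finsetSum _ fun i _ => h2 i,
    ← Finset.sum_neg_distrib]
  refine Finset.sum_congr rfl fun i _ => ?_
  have := integral_mul_fderiv_eq_neg_fderiv_mul_of_integrable (μ := volume)
    (v := EuclideanSpace.single i (1 : ℝ)) (h1 i) (h2 i) (h3 i)
    (fun x _ => hf.differentiable (by norm_num) x)
    (fun x _ => (hgd i).differentiable (by norm_num) x)
  rw [← neg_eq_iff_eq_neg] at this
  exact this.symm

/-- Green's second identity. -/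
lemma integral_mul_lap_comm (hf : ContDiff ℝ 2 f) (hg : ContDiff ℝ 2 g)
    (hc : HasCompactSupport g) : ∫ x, f x * lap g x = ∫ x, lap f x * g x := by
  have h1 := integral_gradDot (hf.of_le (by norm_num)) hg (Or.inr hc)
  have h2 := integral_gradDot (hg.of_le (by norm_num)) hf (Or.inl hc)
  rw [gradDot_comm, h1, neg_inj] at h2
  rw [h2]
  simp only [mul_comm]

open scoped Convolution Pointwise in
lemma exists_smooth_approx (hf : ContDiff ℝ 2 f) (hc : HasCompactSupport f) :
    ∃ (ψ : ℕ → EuclideanSpace ℝ (Fin n) → ℝ) (M : ℝ) (K : Set (EuclideanSpace ℝ (Fin n))),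
      IsCompact K ∧ (∀ k, ContDiff ℝ (⊤ : ℕ∞) (ψ k) ∧ HasCompactSupport (ψ k)) ∧
      (∀ k, ∀ x ∉ K, ψ k x = 0 ∧ lap (ψ k) x = 0) ∧
      (∀ k x, |ψ k x| ≤ M ∧ |lap (ψ k) x| ≤ M) ∧
      (∀ x, Tendsto (fun k => ψ k x) atTop (𝓝 (f x))) ∧
      (∀ x, Tendsto (fun k => lap (ψ k) x) atTop (𝓝 (lap f x))) := by
  let b : ℕ → ContDiffBump (0 : EuclideanSpace ℝ (Fin n)) := fun k =>
    ⟨1 / (k + 1 : ℝ) / 2, 1 / (k + 1 : ℝ), by positivity, by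
      have : (0 : ℝ) < 1 / (k + 1 : ℝ) := by positivity
      linarith⟩
  have hb0 : Tendsto (fun k => (b k).rOut) atTop (𝓝 0) :=
    tendsto_one_div_add_atTop_nhds_zero_nat
  have hb1 : ∀ k, (b k).rOut ≤ 1 := fun k => by
    change 1 / (k + 1 : ℝ) ≤ 1
    rw [div_le_one (by positivity)]
    linarith [(Nat.cast_nonneg k : (0 : ℝ) ≤ k)]
  let C : (EuclideanSpace ℝ (Fin n) → ℝ) → ℕ → EuclideanSpace ℝ (Fin n) → ℝ := fun g k =>
    (b k).normed volume ⋆[ContinuousLinearMap.lsmul ℝ ℝ, volume] g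
  have hloc : ∀ k, LocallyIntegrable ((b k).normed volume) volume := fun k =>
    (b k).integrable_normed.locallyIntegrable
  have hpd : ∀ (g : EuclideanSpace ℝ (Fin n) → ℝ), ContDiff ℝ 1 g → HasCompactSupport g →
      ∀ k i, partialDeriv i (C g k) = C (partialDeriv i g) k := by
    intro g hg hgc k i
    funext x
    have := (hgc.hasFDerivAt_convolution_right (ContinuousLinearMap.lsmul ℝ ℝ) (hloc k) hg x).fderiv
    simp only [partialDeriv, C]
    rw [this, convolution_precompR_apply _ (hloc k) (hgc.fderiv ℝ) (hg.continuous_fderiv (by norm_num))]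
    rfl
  have hlim : ∀ (g : EuclideanSpace ℝ (Fin n) → ℝ), Continuous g → ∀ x,
      Tendsto (fun k => C g k x) atTop (𝓝 (g x)) := fun g hg x =>
    ContDiffBump.convolution_tendsto_right_of_continuous hb0 hg x
  have hbd : ∀ (g : EuclideanSpace ℝ (Fin n) → ℝ), Continuous g → HasCompactSupport g →
      ∃ M, ∀ k x, |C g k x| ≤ M := by
    intro g hg hgc
    obtain ⟨M, hM⟩ := hgc.exists_bound_of_continuous hg
    refine ⟨3 * M, fun k x => ?_⟩
    have h1 : dist (C g k x) (g x) ≤ 2 * M := by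
      refine ContDiffBump.dist_normed_convolution_le hg.aestronglyMeasurable fun y _ => ?_
      rw [dist_eq_norm]
      linarith [norm_sub_le (g y) (g x), hM x, hM y]
    rw [Real.dist_eq] at h1
    have h2 := hM x
    rw [Real.norm_eq_abs] at h2
    have := abs_sub_abs_le_abs_sub (C g k x) (g x)
    linarith
  have hfd := fun i => contDiff_partialDeriv (k := 1) hf (by norm_num) i
  have hfdd := fun i => contDiff_partialDeriv (k := 0) (hfd i) (by norm_num) i
  have hfdc := fun i => hasCompactSupport_partialDeriv hc i
  have hfddc := fun i => hasCompactSupport_partialDeriv (hfdc i) i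
  have hsm : ∀ k, ContDiff ℝ (⊤ : ℕ∞) (C f k) := fun k =>
    (b k).hasCompactSupport_normed.contDiff_convolution_left _ (b k).contDiff_normed
      hf.continuous.locallyIntegrable
  have hsupp : ∀ k, Function.support (C f k) ⊆ Metric.closedBall 0 1 + tsupport f := fun k => by
    refine (support_convolution_subset _).trans (Set.add_subset_add ?_ (subset_tsupport f))
    rw [ContDiffBump.support_normed_eq]
    exact (Metric.ball_subset_ball (hb1 k)).trans Metric.ball_subset_closedBall
  have hK : IsCompact (Metric.closedBall (0 : EuclideanSpace ℝ (Fin n)) 1 + tsupport f) :=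
    (isCompact_closedBall 0 1).add hc
  have hlap : ∀ k x, lap (C f k) x = ∑ i, C (partialDeriv i (partialDeriv i f)) k x := by
    intro k x
    rw [lap_eq_sum (contDiff_of_smooth (hsm k) 2)]
    refine Finset.sum_congr rfl fun i _ => ?_
    rw [hpd f (hf.of_le (by norm_num)) hc, hpd _ (hfd i) (hfdc i)]
  obtain ⟨M₀, hM₀⟩ := hbd f hf.continuous hc
  choose M hM using fun i => hbd _ (hfdd i).continuous (hfddc i)
  refine ⟨C f, max M₀ (∑ i, M i), _, hK,
    fun k => ⟨hsm k, HasCompactSupport.of_support_subset_isCompact hK (hsupp k)⟩,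
    fun k x hx => ⟨?_, ?_⟩, fun k x => ⟨(hM₀ k x).trans (le_max_left _ _), ?_⟩,
    hlim f hf.continuous, fun x => ?_⟩
  · by_contra h
    exact hx (hsupp k h)
  · exact lap_eq_zero_of_notMem_tsupport fun h =>
      hx (closure_minimal (hsupp k) hK.isClosed h)
  · refine le_trans ?_ (le_max_right _ _)
    rw [hlap]
    exact (Finset.abs_sum_le_sum_abs _ _).trans (Finset.sum_le_sum fun i _ => hM i k x)
  · simp only [hlap, lap_eq_sum hf]
    exact tendsto_finsetSum _ fun i _ => hlim _ (hfdd i).continuous x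

/-- A positive classical solution of `Δ²u = u^p` on `ℝⁿ` which is stable. -/
structure IsStableSolution (p : ℝ) (u : EuclideanSpace ℝ (Fin n) → ℝ) : Prop where
  contDiff : ContDiff ℝ 4 u
  pos : ∀ x, 0 < u x
  lap_lap : ∀ x, lap (lap u) x = u x ^ p
  stable : ∀ φ : EuclideanSpace ℝ (Fin n) → ℝ, ContDiff ℝ (⊤ : ℕ∞) φ → HasCompactSupport φ →
    p * ∫ x, u x ^ (p - 1) * φ x ^ 2 ≤ ∫ x, (lap φ x) ^ 2

namespace IsStableSolution

variable {p : ℝ} {u : EuclideanSpace ℝ (Fin n) → ℝ}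

lemma contDiff_rpow (hu : IsStableSolution p u) (q : ℝ) : ContDiff ℝ 4 fun x => u x ^ q :=
  hu.contDiff.rpow_const_of_ne fun x => (hu.pos x).ne'

lemma stable_of_contDiff_two (hu : IsStableSolution p u) (hf : ContDiff ℝ 2 f)
    (hc : HasCompactSupport f) :
    p * ∫ x, u x ^ (p - 1) * f x ^ 2 ≤ ∫ x, (lap f x) ^ 2 := by
  obtain ⟨ψ, M, K, hK, hψ, hψK, hψM, hψ1, hψ2⟩ := exists_smooth_approx hf hc
  have hw := (hu.contDiff_rpow (p - 1)).continuous
  obtain ⟨W, hW⟩ := hK.exists_bound_of_continuousOn hw.continuousOn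
  have hInt : ∀ c : ℝ, Integrable (K.indicator fun _ => c) := fun c =>
    (integrable_indicator_iff hK.measurableSet).2
      (integrableOn_const (hK.measure_lt_top.ne) (by simp))
  have hsq : ∀ {a : ℝ}, |a| ≤ M → a ^ 2 ≤ M ^ 2 := fun h => sq_le_sq' (abs_le.1 h).1 (abs_le.1 h).2
  have h2ψ : ∀ k, ContDiff ℝ 2 (ψ k) := fun k => contDiff_of_smooth (hψ k).1 2
  have t1 : Tendsto (fun k => ∫ x, u x ^ (p - 1) * ψ k x ^ 2) atTop
      (𝓝 (∫ x, u x ^ (p - 1) * f x ^ 2)) := by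
    refine tendsto_integral_of_dominated_convergence (K.indicator fun _ => W * M ^ 2)
      (fun k => (hw.mul ((h2ψ k).continuous.pow 2)).aestronglyMeasurable) (hInt _)
      (fun k => .of_forall fun x => ?_)
      (.of_forall fun x => tendsto_const_nhds.mul ((hψ1 x).pow 2))
    by_cases hx : x ∈ K
    · rw [Set.indicator_of_mem hx, norm_mul, Real.norm_eq_abs (ψ k x ^ 2), abs_of_nonneg (sq_nonneg _)]
      exact mul_le_mul (hW x hx) (hsq (hψM k x).1) (sq_nonneg _) ((norm_nonneg _).trans (hW x hx))
    · rw [Set.indicator_of_notMem hx, (hψK k x hx).1]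
      simp
  have t2 : Tendsto (fun k => ∫ x, lap (ψ k) x ^ 2) atTop (𝓝 (∫ x, lap f x ^ 2)) := by
    refine tendsto_integral_of_dominated_convergence (K.indicator fun _ => M ^ 2)
      (fun k => ((continuous_lap (h2ψ k)).pow 2).aestronglyMeasurable) (hInt _)
      (fun k => .of_forall fun x => ?_)
      (.of_forall fun x => (hψ2 x).pow 2)
    by_cases hx : x ∈ K
    · rw [Set.indicator_of_mem hx, Real.norm_eq_abs, abs_of_nonneg (sq_nonneg _)]
      exact hsq (hψM k x).2
    · rw [Set.indicator_of_notMem hx, (hψK k x hx).2]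
      simp
  exact le_of_tendsto_of_tendsto' (t1.const_mul p) t2 fun k => hu.stable _ (hψ k).1 (hψ k).2

/-- The equation and the stability are invariant under the natural rescaling. -/
lemma rescale (hu : IsStableSolution p u) (hp : 1 < p) (x₀ : EuclideanSpace ℝ (Fin n)) {R : ℝ}
    (hR : 0 < R) : IsStableSolution p fun x => R ^ (4 / (p - 1)) * u (x₀ + R • x) := by
  have hp1 : p - 1 ≠ 0 := by linarith
  have hu2 : ContDiff ℝ 2 u := hu.contDiff.of_le (by norm_num)
  have hlu2 : ContDiff ℝ 2 (lap u) := contDiff_lap hu.contDiff (by norm_num)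
  have hA : 0 < R ^ (4 / (p - 1)) := Real.rpow_pos_of_pos hR _
  have hA1 : (R ^ (4 / (p - 1))) ^ (p - 1) = R ^ 4 := by
    rw [← Real.rpow_mul hR.le, div_mul_cancel₀ _ hp1]
    exact_mod_cast Real.rpow_natCast R 4
  refine ⟨contDiff_const.mul (contDiff_comp_affine hu.contDiff x₀ R),
    fun x => mul_pos hA (hu.pos _), fun x => ?_, fun φ hφ hφc => ?_⟩
  · rw [lap_const_mul (contDiff_comp_affine hu2 x₀ R), lap_comp_affine hu2, lap_const_mul
      (contDiff_const.mul (contDiff_comp_affine hlu2 x₀ R)),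
      lap_const_mul (contDiff_comp_affine hlu2 x₀ R), lap_comp_affine hlu2]
    simp only [hu.lap_lap]
    rw [Real.mul_rpow hA.le (hu.pos _).le]
    have : (R ^ (4 / (p - 1))) ^ p = R ^ (4 / (p - 1)) * R ^ 4 := by
      rw [← hA1]
      nth_rw 2 [← Real.rpow_one (R ^ (4 / (p - 1)))]
      rw [← Real.rpow_add hA]
      ring_nf
    rw [this]
    ring
  · have hφ2 : ContDiff ℝ 2 φ := contDiff_of_smooth hφ 2
    set ψ : EuclideanSpace ℝ (Fin n) → ℝ := fun y => φ (-(R⁻¹ • x₀) + R⁻¹ • y) with hψ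
    have hψφ : ∀ x, -(R⁻¹ • x₀) + R⁻¹ • (x₀ + R • x) = x := fun x => by
      rw [smul_add, smul_smul, inv_mul_cancel₀ hR.ne']
      simp
    have hψc : HasCompactSupport ψ := by
      have := hφc.comp_homeomorph ((Homeomorph.smulOfNeZero R⁻¹ (inv_ne_zero hR.ne')).trans
        (Homeomorph.addLeft (-(R⁻¹ • x₀))))
      exact this
    have key := hu.stable ψ (contDiff_comp_affine hφ _ _) hψc
    have cv : ∀ F : EuclideanSpace ℝ (Fin n) → ℝ,
        ∫ x, F (x₀ + R • x) = |(R ^ n)⁻¹| * ∫ x, F x := fun F => by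
      have h1 := Measure.integral_comp_smul volume (fun y => F (x₀ + y)) R
      rw [finrank_euclideanSpace_fin, smul_eq_mul, integral_add_left_eq_self F x₀] at h1
      exact h1
    have e1 : ∫ x, (R ^ (4 / (p - 1)) * u (x₀ + R • x)) ^ (p - 1) * φ x ^ 2 =
        R ^ 4 * (|(R ^ n)⁻¹| * ∫ x, u x ^ (p - 1) * ψ x ^ 2) := by
      rw [← cv, ← integral_const_mul]
      refine integral_congr_ae (.of_forall fun x => ?_)
      simp only [hψ, hψφ]
      rw [Real.mul_rpow hA.le (hu.pos _).le, hA1]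
      ring
    have e2 : ∫ x, lap φ x ^ 2 = R ^ 4 * (|(R ^ n)⁻¹| * ∫ x, lap ψ x ^ 2) := by
      rw [← cv, ← integral_const_mul]
      refine integral_congr_ae (.of_forall fun x => ?_)
      simp only [hψ, lap_comp_affine hφ2, hψφ]
      field_simp
    rw [e1, e2]
    have := mul_le_mul_of_nonneg_left key (mul_nonneg (pow_nonneg hR.le 4) (abs_nonneg (R ^ n)⁻¹))
    linarith

end IsStableSolution

lemma exists_cutoff {r : ℝ} (hr : 0 < r) :
    ∃ ζ : EuclideanSpace ℝ (Fin n) → ℝ, ContDiff ℝ (⊤ : ℕ∞) ζ ∧ HasCompactSupport ζ ∧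
      (∀ x, 0 ≤ ζ x ∧ ζ x ≤ 1) ∧ ∀ x, ‖x‖ < r + 1 → ζ x = 1 := by
  let b : ContDiffBump (0 : EuclideanSpace ℝ (Fin n)) :=
    ⟨r + 1, r + 2, by linarith, by linarith⟩
  refine ⟨b, b.contDiff, b.hasCompactSupport, fun x => ⟨b.nonneg, b.le_one⟩, fun x hx => ?_⟩
  exact b.one_of_mem_closedBall (mem_closedBall_zero_iff.2 hx.le)

lemma lap_pow (hf : ContDiff ℝ 2 f) (k : ℕ) (x : EuclideanSpace ℝ (Fin n)) :
    lap (fun x => f x ^ (k + 2)) x =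
      f x ^ k * ((k + 2) * f x * lap f x + (k + 2) * (k + 1) * gradDot f f x) := by
  have hf' : Differentiable ℝ f := hf.differentiable (by norm_num)
  have hfd := fun i => (contDiff_partialDeriv (k := 1) hf (by norm_num) i).differentiable
    (by norm_num)
  have hd : ∀ (m : ℕ) (i : Fin n), partialDeriv i (fun x => f x ^ (m + 1)) =
      fun x => (m + 1 : ℝ) * f x ^ m * partialDeriv i f x := fun m i =>
    partialDeriv_comp (F := fun t => t ^ (m + 1)) (F' := fun t => (m + 1 : ℝ) * t ^ m) hf'
      (fun y => by simpa using hasDerivAt_pow (m + 1) (f y)) i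
  rw [lap_eq_sum hf, lap_eq_sum (hf.pow (k + 2))]
  simp only [gradDot, Finset.mul_sum, ← Finset.sum_add_distrib]
  refine Finset.sum_congr rfl fun i _ => ?_
  rw [hd (k + 1), partialDeriv_mul ((hf'.fun_pow (k + 1)).const_mul _) (hfd i),
    partialDeriv_const_mul (hf'.fun_pow (k + 1)), hd k]
  push_cast
  ring

lemma gradDot_pow_self (hf : Differentiable ℝ f) (m : ℕ) (x : EuclideanSpace ℝ (Fin n)) :
    gradDot (fun x => f x ^ (m + 1)) (fun x => f x ^ (m + 1)) x =
      (m + 1) ^ 2 * f x ^ (2 * m) * gradDot f f x := by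
  rw [gradDot_pow hf, gradDot_comm, gradDot_pow hf]
  ring

lemma exists_bound_pow_mul (hf : HasCompactSupport f) (hf0 : ∀ x, 0 ≤ f x) (hg : Continuous g) :
    ∃ A, 0 ≤ A ∧ ∀ k ≠ 0, ∀ x, |f x ^ k * g x| ≤ A * f x ^ k := by
  obtain ⟨A, hA⟩ := hf.isCompact.exists_bound_of_continuousOn hg.continuousOn
  refine ⟨max A 0, le_max_right _ _, fun k hk x => ?_⟩
  by_cases hx : x ∈ tsupport f
  · rw [abs_mul, abs_of_nonneg (pow_nonneg (hf0 x) k), mul_comm]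
    exact mul_le_mul_of_nonneg_right ((hA x hx).trans (le_max_left _ _)) (pow_nonneg (hf0 x) k)
  · simp [image_eq_zero_of_notMem_tsupport hx, hk]

/-- Control of the derivatives of the power of a cutoff function by lower powers. -/
lemma exists_bound_cutoff_pow (hf : ContDiff ℝ (⊤ : ℕ∞) f) (hc : HasCompactSupport f)
    (hf0 : ∀ x, 0 ≤ f x ∧ f x ≤ 1) {k : ℕ} (hk : k ≠ 0) :
    ∃ A, 0 ≤ A ∧ ∀ x,
      gradDot (fun x => f x ^ (k + 2)) (fun x => f x ^ (k + 2)) x ≤ A * (f x ^ (k + 2) * f x ^ k) ∧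
      |lap (fun x => f x ^ (k + 2)) x| ≤ A * f x ^ k ∧
      |lap (gradDot (fun x => f x ^ (k + 2)) (fun x => f x ^ (k + 2))) x| ≤ A * (f x ^ k) ^ 2 := by
  have hf1 : Differentiable ℝ f := hf.differentiable (by simp)
  have hf2 : ContDiff ℝ 2 f := contDiff_of_smooth hf 2
  have hf3 : ContDiff ℝ 3 f := contDiff_of_smooth hf 3
  have hg2 : ContDiff ℝ 2 (gradDot f f) := contDiff_gradDot hf3 hf3 (by norm_num)
  have cf := hf.continuous
  have cl := continuous_lap hf2
  have cg := hg2.continuous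
  have clg := continuous_lap hg2
  have cgg := continuous_gradDot (hf2.of_le (by norm_num)) (hg2.of_le (by norm_num))
  obtain ⟨A₁, hA₁, h₁⟩ := exists_bound_pow_mul hc (fun x => (hf0 x).1)
    (g := fun x => (k + 2 : ℝ) ^ 2 * gradDot f f x) (by fun_prop)
  obtain ⟨A₂, hA₂, h₂⟩ := exists_bound_pow_mul hc (fun x => (hf0 x).1)
    (g := fun x => (k + 2) * f x * lap f x + (k + 2) * (k + 1) * gradDot f f x) (by fun_prop)
  obtain ⟨A₃, hA₃, h₃⟩ := exists_bound_pow_mul hc (fun x => (hf0 x).1)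
    (g := fun x => (k + 2 : ℝ) ^ 2 * (f x ^ 2 * lap (gradDot f f) x
      + 2 * ((2 * k + 1 : ℕ) + 1) * f x * gradDot f (gradDot f f) x
      + gradDot f f x * (((2 * k : ℕ) + 2) * f x * lap f x +
        ((2 * k : ℕ) + 2) * ((2 * k : ℕ) + 1) * gradDot f f x))) (by fun_prop)
  have hξ : gradDot (fun x => f x ^ (k + 2)) (fun x => f x ^ (k + 2)) =
      fun x => (k + 2 : ℝ) ^ 2 * (f x ^ (2 * k + 2) * gradDot f f x) := by
    funext x
    rw [gradDot_pow_self hf1 (k + 1)]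
    push_cast
    ring
  refine ⟨A₁ + A₂ + A₃, by positivity, fun x => ⟨?_, ?_, ?_⟩⟩
  · rw [hξ]
    have := (le_abs_self _).trans (h₁ (k + 2 + k) (by omega) x)
    calc _ = f x ^ (k + 2 + k) * ((k + 2 : ℝ) ^ 2 * gradDot f f x) := by ring
      _ ≤ _ := this
      _ ≤ _ := by
        rw [← pow_add]
        exact mul_le_mul_of_nonneg_right (by linarith) (pow_nonneg (hf0 x).1 _)
  · rw [lap_pow hf2]
    exact (h₂ k hk x).trans
      (mul_le_mul_of_nonneg_right (by linarith) (pow_nonneg (hf0 x).1 _))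
  · rw [hξ, lap_const_mul ((hf2.pow _).mul hg2)]
    beta_reduce
    rw [lap_mul (hf2.pow _) hg2, lap_pow hf2, gradDot_pow hf1]
    calc _ = |f x ^ (2 * k) * ((k + 2 : ℝ) ^ 2 * (f x ^ 2 * lap (gradDot f f) x
          + 2 * ((2 * k + 1 : ℕ) + 1) * f x * gradDot f (gradDot f f) x
          + gradDot f f x * (((2 * k : ℕ) + 2) * f x * lap f x +
            ((2 * k : ℕ) + 2) * ((2 * k : ℕ) + 1) * gradDot f f x)))| := by
          congr 1
          ring
      _ ≤ _ := h₃ (2 * k) (by omega) x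
      _ ≤ _ := by
        rw [mul_comm 2 k, pow_mul]
        exact mul_le_mul_of_nonneg_right (by linarith) (by positivity)

lemma setIntegral_green (hf : ContDiff ℝ 2 f) (hg : ContDiff ℝ 2 g)
    {K : Set (EuclideanSpace ℝ (Fin n))} (hK : IsCompact K) (hgK : tsupport g ⊆ K) :
    ∫ x in K, (f x * lap g x - lap f x * g x) = 0 := by
  have hc : HasCompactSupport g := HasCompactSupport.intro hK fun x hx =>
    image_eq_zero_of_notMem_tsupport fun h => hx (hgK h)
  rw [setIntegral_eq_integral_of_forall_compl_eq_zero, integral_sub, integral_mul_lap_comm hf hg hc,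
    sub_self]
  · exact (hf.continuous.mul (continuous_lap hg)).integrable_of_hasCompactSupport
      (hasCompactSupport_lap hc).mul_left
  · exact ((continuous_lap hf).mul hg.continuous).integrable_of_hasCompactSupport hc.mul_left
  · intro x hx
    have : x ∉ tsupport g := fun h => hx (hgK h)
    rw [lap_eq_zero_of_notMem_tsupport this, image_eq_zero_of_notMem_tsupport this]
    ring

lemma sq_mul_pow_le {p : ℝ} (hp : 1 < p) {k : ℕ} (hk : 4 ≤ k * (p - 1)) {C θ : ℝ} (hC : 0 ≤ C)
    (hθ : 0 < θ) :
    ∃ D, ∀ a z : ℝ, 0 < a → 0 ≤ z → z ≤ 1 →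
      C * (a ^ 2 * (z ^ k) ^ 2) ≤ θ * (a ^ (p + 1) * (z ^ (k + 2)) ^ 2) + D := by
  set B := C / θ with hB
  have hB0 : 0 ≤ B := div_nonneg hC hθ.le
  have hCB : C = θ * B := by rw [hB]; field_simp
  refine ⟨C * (B ^ (1 / (p - 1))) ^ 2, fun a z ha hz hz1 => ?_⟩
  have hp1 : 0 < p - 1 := by linarith
  have hap : a ^ (p + 1) = a ^ 2 * a ^ (p - 1) := by
    rw [← Real.rpow_natCast, ← Real.rpow_add ha]
    norm_num
    ring_nf
  have hD : 0 ≤ C * (B ^ (1 / (p - 1))) ^ 2 := by positivity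
  have hap0 : 0 < a ^ (p - 1) := Real.rpow_pos_of_pos ha _
  by_cases hcase : B ≤ a ^ (p - 1) * z ^ 4
  · have h1 : C * (a ^ 2 * (z ^ k) ^ 2) ≤ θ * (a ^ (p + 1) * (z ^ (k + 2)) ^ 2) := by
      calc C * (a ^ 2 * (z ^ k) ^ 2) = θ * (a ^ 2 * (z ^ k) ^ 2) * B := by rw [hCB]; ring
        _ ≤ θ * (a ^ 2 * (z ^ k) ^ 2) * (a ^ (p - 1) * z ^ 4) :=
          mul_le_mul_of_nonneg_left hcase (by positivity)
        _ = _ := by rw [hap]; ring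
    linarith
  · push Not at hcase
    have hzk : (z ^ k) ^ (p - 1) ≤ z ^ 4 := by
      rw [← Real.rpow_natCast z k, ← Real.rpow_mul hz, ← Real.rpow_natCast z 4]
      exact Real.rpow_le_rpow_of_exponent_ge' hz hz1 (by norm_num) (by exact_mod_cast hk)
    have h1 : (a * z ^ k) ^ (p - 1) ≤ B := by
      rw [Real.mul_rpow ha.le (pow_nonneg hz k)]
      exact (mul_le_mul_of_nonneg_left hzk hap0.le).trans hcase.le
    have h2 : a * z ^ k ≤ B ^ (1 / (p - 1)) := by
      have := Real.rpow_le_rpow (by positivity) h1 (z := 1 / (p - 1)) (by positivity)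
      rwa [← Real.rpow_mul (by positivity), mul_one_div_cancel hp1.ne', Real.rpow_one] at this
    have h3 : (a * z ^ k) ^ 2 ≤ (B ^ (1 / (p - 1))) ^ 2 := pow_le_pow_left₀ (by positivity) h2 2
    have h4 : 0 ≤ θ * (a ^ (p + 1) * (z ^ (k + 2)) ^ 2) := by positivity
    have h5 := mul_le_mul_of_nonneg_left h3 hC
    rw [mul_pow] at h5
    linarith

lemma energy_pointwise {p θ A a q b s G h ξ L η τ : ℝ} (hθ : 0 < θ) (hpθ : p = 1 + 2 * θ)
    (hs : s ^ 2 ≤ G * ξ) (hξ0 : 0 ≤ ξ)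
    (hξ : ξ ≤ A * (η * τ)) (hh : |h| ≤ A * τ) (hL : |L| ≤ A * τ ^ 2) :
    ((η * b + 2 * s + a * h) ^ 2 - p * (q * η ^ 2))
      - (1 + θ) * (b * (η ^ 2 * b + 4 * η * s + a * (2 * η * h + 2 * ξ)) - q * η ^ 2)
      + (3 + 8 * θ) * (a ^ 2 * L - (2 * G + 2 * (a * b)) * ξ) ≤
    -θ * (q * η ^ 2) - θ / 4 * (b ^ 2 * η ^ 2)
      + (3 * A ^ 2 + (3 + 8 * θ) * A + (8 + 18 * θ) ^ 2 * A ^ 2 / θ + 4 * θ * A ^ 2)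
        * (a ^ 2 * τ ^ 2) := by
  have e1 : a ^ 2 * h ^ 2 ≤ A ^ 2 * (a ^ 2 * τ ^ 2) := by
    have : h ^ 2 ≤ (A * τ) ^ 2 := sq_le_sq' (abs_le.1 hh).1 (abs_le.1 hh).2
    nlinarith [mul_le_mul_of_nonneg_left this (sq_nonneg a)]
  have e2 : a ^ 2 * L ≤ A * (a ^ 2 * τ ^ 2) := by
    nlinarith [mul_le_mul_of_nonneg_left ((le_abs_self L).trans hL) (sq_nonneg a)]
  have hab : |a * b| * (A * (η * τ)) = A * (|b| * η) * (|a| * τ) := by rw [abs_mul]; ring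
  have habsq : (|b| * η) ^ 2 = b ^ 2 * η ^ 2 := by rw [mul_pow, sq_abs]
  have habsq' : (|a| * τ) ^ 2 = a ^ 2 * τ ^ 2 := by rw [mul_pow, sq_abs]
  have e3 : -((8 + 18 * θ) * (a * b * ξ)) ≤ θ / 4 * (b ^ 2 * η ^ 2)
      + (8 + 18 * θ) ^ 2 * A ^ 2 / θ * (a ^ 2 * τ ^ 2) := by
    have h1 : -(a * b * ξ) ≤ A * (|b| * η) * (|a| * τ) := by
      rw [← hab]
      calc -(a * b * ξ) ≤ |a * b| * ξ := by nlinarith [neg_abs_le (a * b)]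
        _ ≤ _ := mul_le_mul_of_nonneg_left hξ (abs_nonneg _)
    have h2 : (8 + 18 * θ) * (A * (|b| * η) * (|a| * τ)) ≤ θ / 4 * (|b| * η) ^ 2
        + (8 + 18 * θ) ^ 2 * A ^ 2 / θ * (|a| * τ) ^ 2 := by
      have : 0 ≤ (θ * (|b| * η) / 2 - (8 + 18 * θ) * A * (|a| * τ)) ^ 2 / θ := by positivity
      have e : (θ * (|b| * η) / 2 - (8 + 18 * θ) * A * (|a| * τ)) ^ 2 / θ =
        θ / 4 * (|b| * η) ^ 2 + (8 + 18 * θ) ^ 2 * A ^ 2 / θ * (|a| * τ) ^ 2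
          - (8 + 18 * θ) * (A * (|b| * η) * (|a| * τ)) := by
        field_simp
        ring
      linarith
    rw [habsq, habsq'] at h2
    have := mul_le_mul_of_nonneg_left h1 (by positivity : 0 ≤ 8 + 18 * θ)
    linarith
  have e4 : -(2 * (a * b * η * h)) ≤ 1 / 4 * (b ^ 2 * η ^ 2) + 4 * A ^ 2 * (a ^ 2 * τ ^ 2) := by
    nlinarith [sq_nonneg (b * η / 2 + 2 * a * h)]
  have e5 : 4 * (a * s * h) ≤ 2 * (a ^ 2 * h ^ 2) + 2 * s ^ 2 := by
    nlinarith [sq_nonneg (a * h - s)]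
  have e6 : -(4 * (b * η * s)) ≤ 1 / 4 * (b ^ 2 * η ^ 2) + 16 * s ^ 2 := by
    nlinarith [sq_nonneg (b * η / 2 + 4 * s)]
  have e4' := mul_le_mul_of_nonneg_left e4 hθ.le
  have e6' := mul_le_mul_of_nonneg_left e6 hθ.le
  have e2' := mul_le_mul_of_nonneg_left e2 (by positivity : 0 ≤ 3 + 8 * θ)
  have hs' := mul_le_mul_of_nonneg_left hs (by positivity : 0 ≤ 6 + 16 * θ)
  subst hpθ
  linarith

namespace IsStableSolution

variable {p : ℝ} {u : EuclideanSpace ℝ (Fin n) → ℝ}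

lemma setIntegral_stable (hu : IsStableSolution p u) (hf : ContDiff ℝ 2 f)
    {K : Set (EuclideanSpace ℝ (Fin n))} (hK : IsCompact K) (hfK : tsupport f ⊆ K) :
    0 ≤ ∫ x in K, (lap f x ^ 2 - p * (u x ^ (p - 1) * f x ^ 2)) := by
  have hc : HasCompactSupport f := HasCompactSupport.intro hK fun x hx =>
    image_eq_zero_of_notMem_tsupport fun h => hx (hfK h)
  have hw := (hu.contDiff_rpow (p - 1)).continuous
  rw [setIntegral_eq_integral_of_forall_compl_eq_zero, integral_sub, integral_const_mul]
  · linarith [hu.stable_of_contDiff_two hf hc]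
  · exact ((continuous_lap hf).pow 2).integrable_of_hasCompactSupport
      (HasCompactSupport.intro hc fun x hx => by simp [lap_eq_zero_of_notMem_tsupport hx])
  · exact (continuous_const.mul (hw.mul (hf.continuous.pow 2))).integrable_of_hasCompactSupport
      (HasCompactSupport.intro hc fun x hx => by simp [image_eq_zero_of_notMem_tsupport hx])
  · intro x hx
    have : x ∉ tsupport f := fun h => hx (hfK h)
    rw [lap_eq_zero_of_notMem_tsupport this, image_eq_zero_of_notMem_tsupport this]
    ring

end IsStableSolution

namespace IsStableSolution

variable {p : ℝ}

lemma exists_bound_sq (hp : 1 < p) {r : ℝ} (hr : 0 < r) :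
    ∃ C, ∀ u : EuclideanSpace ℝ (Fin n) → ℝ, IsStableSolution p u →
      ∫ x in Metric.closedBall 0 r, (u x ^ 2 + lap u x ^ 2) ≤ C := by
  obtain ⟨ζ, hζ, hζc, hζ0, hζ1⟩ := exists_cutoff (n := n) hr
  have hp1 : 0 < p - 1 := by linarith
  obtain ⟨k, hk⟩ := exists_nat_ge (4 / (p - 1))
  rw [div_le_iff₀ hp1] at hk
  have hk0 : k ≠ 0 := by
    rintro rfl
    norm_num at hk
  obtain ⟨A, hA, hbd⟩ := exists_bound_cutoff_pow hζ hζc hζ0 hk0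
  set θ := (p - 1) / 2 with hθdef
  have hθ : 0 < θ := by positivity
  set c := 3 * A ^ 2 + (3 + 8 * θ) * A + (8 + 18 * θ) ^ 2 * A ^ 2 / θ + 4 * θ * A ^ 2 with hc
  obtain ⟨D, hD⟩ := sq_mul_pow_le hp hk (C := c) (by positivity) (half_pos hθ)
  set K := tsupport ζ with hKdef
  have hK : IsCompact K := hζc
  set η : EuclideanSpace ℝ (Fin n) → ℝ := fun x => ζ x ^ (k + 2) with hη
  have hηs : ContDiff ℝ (⊤ : ℕ∞) η := hζ.pow _
  have hη2 : ContDiff ℝ 2 η := contDiff_of_smooth hηs 2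
  have hη3 : ContDiff ℝ 3 η := contDiff_of_smooth hηs 3
  have hηK : tsupport η ⊆ K := closure_mono fun x hx => by
    contrapose! hx
    simp [hη, Function.notMem_support.1 hx]
  have hsub : ∀ F : EuclideanSpace ℝ (Fin n) → ℝ, (∀ x, η x = 0 → F x = 0) → tsupport F ⊆ K :=
    fun F hF => (closure_mono fun x hx => by contrapose! hx; simpa using hF x (by simpa using hx)).trans hηK
  have hξ2 : ContDiff ℝ 2 (gradDot η η) := contDiff_gradDot hη3 hη3 (by norm_num)
  have hξK : tsupport (gradDot η η) ⊆ K := by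
    refine closure_minimal (fun x hx => ?_) (isClosed_tsupport ζ)
    by_contra h
    exact hx (gradDot_eq_zero_of_notMem_tsupport fun h' => h (hηK h'))
  have hballK : Metric.closedBall 0 r ⊆ K := fun x hx => by
    refine subset_tsupport _ ?_
    rw [Function.mem_support, hζ1 x (by linarith [mem_closedBall_zero_iff.1 hx])]
    norm_num
  refine ⟨(1 + 4 / θ * D) * volume.real K, fun u hu => ?_⟩
  have hu2 : ContDiff ℝ 2 u := hu.contDiff.of_le (by norm_num)
  have hlu2 : ContDiff ℝ 2 (lap u) := contDiff_lap hu.contDiff (by norm_num)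
  have hInt : ∀ {F : EuclideanSpace ℝ (Fin n) → ℝ}, Continuous F → IntegrableOn F K volume :=
    fun hF => hF.continuousOn.integrableOn_compact hK
  have hη22 : ContDiff ℝ 2 fun x => η x * η x := hη2.mul hη2
  have I1 := hu.setIntegral_stable (hu2.mul hη2) hK (hsub _ fun x hx => by simp [hx])
  have I2 := setIntegral_green hlu2 (hu2.mul hη22) hK (hsub _ fun x hx => by simp [hx])
  have I3 := setIntegral_green (hu2.mul hu2) hξ2 hK hξK
  have cu := hu2.continuous
  have cb := hlu2.continuous
  have cη := hη2.continuous
  have cw := (hu.contDiff_rpow (p - 1)).continuous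
  have cq := (hu.contDiff_rpow (p + 1)).continuous
  have c1 := continuous_lap (hu2.mul hη2)
  have c2 := continuous_lap (hu2.mul hη22)
  have c3 := continuous_lap hlu2
  have c4 := continuous_lap hξ2
  have c5 := continuous_lap (hu2.mul hu2)
  have c6 := hξ2.continuous
  set S : EuclideanSpace ℝ (Fin n) → ℝ := fun x =>
    lap (fun y => u y * η y) x ^ 2 - p * (u x ^ (p - 1) * (u x * η x) ^ 2) with hS
  set N₁ : EuclideanSpace ℝ (Fin n) → ℝ := fun x =>
    lap u x * lap (fun y => u y * (η y * η y)) x - lap (lap u) x * (u x * (η x * η x)) with hN₁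
  set N₂ : EuclideanSpace ℝ (Fin n) → ℝ := fun x =>
    u x * u x * lap (gradDot η η) x - lap (fun y => u y * u y) x * gradDot η η x with hN₂
  have iS : IntegrableOn S K volume := hInt (by fun_prop)
  have iN₁ : IntegrableOn N₁ K volume := hInt (by fun_prop)
  have iN₂ : IntegrableOn N₂ K volume := hInt (by fun_prop)
  have I4 : 0 ≤ ∫ x in K, (S x - (1 + θ) * N₁ x + (3 + 8 * θ) * N₂ x) := by
    have iSN : IntegrableOn (fun x => S x - (1 + θ) * N₁ x) K volume := iS.sub (iN₁.const_mul _)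
    rw [integral_add iSN (iN₂.const_mul _), integral_sub iS (iN₁.const_mul _),
      integral_const_mul, integral_const_mul, I2, I3]
    linarith
  have hpt : ∀ x, S x - (1 + θ) * N₁ x + (3 + 8 * θ) * N₂ x ≤
      D - θ / 4 * ((u x ^ (p + 1) + lap u x ^ 2) * η x ^ 2) := fun x => by
    have hux := hu.pos x
    have hq : u x ^ (p - 1) * u x ^ 2 = u x ^ (p + 1) := by
      rw [← Real.rpow_natCast, ← Real.rpow_add hux]
      norm_num
      ring_nf
    have hq' : u x ^ p * u x = u x ^ (p + 1) := (Real.rpow_add_one hux.ne' p).symm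
    have hu1 := hu2.differentiable (by norm_num)
    have hη1 := hη2.differentiable (by norm_num)
    obtain ⟨b1, b2, b3⟩ := hbd x
    have e := energy_pointwise (a := u x) (q := u x ^ (p + 1)) (b := lap u x) (s := gradDot u η x)
      (G := gradDot u u x) (h := lap η x) (ξ := gradDot η η x) (L := lap (gradDot η η) x)
      (η := η x) (τ := ζ x ^ k) hθ (show p = 1 + 2 * θ by rw [hθdef]; ring) (gradDot_sq_le x)
      (gradDot_self_nonneg x) b1 b2 b3
    have d := hD (u x) (ζ x) hux (hζ0 x).1 (hζ0 x).2
    have hηx : ζ x ^ (k + 2) = η x := rfl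
    rw [hηx] at d
    have hpos : 0 ≤ θ / 4 * (u x ^ (p + 1) * η x ^ 2) := by positivity
    have l1 := lap_mul hu2 hη2 x
    have l2 := lap_mul hu2 hη22 x
    have l3 := lap_mul hη2 hη2 x
    have l4 := lap_mul hu2 hu2 x
    have l5 : gradDot u (fun x => η x * η x) x = 2 * η x * gradDot u η x := by
      rw [gradDot_comm, gradDot_mul_left hη1 hη1, gradDot_comm]
      ring
    have r1 : S x = (η x * lap u x + 2 * gradDot u η x + u x * lap η x) ^ 2
        - p * (u x ^ (p + 1) * η x ^ 2) := by
      simp only [hS]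
      rw [l1, ← hq]
      ring
    have r2 : N₁ x = lap u x * (η x ^ 2 * lap u x + 4 * η x * gradDot u η x
        + u x * (2 * η x * lap η x + 2 * gradDot η η x)) - u x ^ (p + 1) * η x ^ 2 := by
      simp only [hN₁]
      rw [l2, l3, l5, hu.lap_lap, ← hq']
      ring
    have r3 : N₂ x = u x ^ 2 * lap (gradDot η η) x
        - (2 * gradDot u u x + 2 * (u x * lap u x)) * gradDot η η x := by
      simp only [hN₂]
      rw [l4]
      ring
    rw [r1, r2, r3]
    linarith
  have I5 := setIntegral_mono (hInt (by fun_prop)) (hInt (by fun_prop)) hpt (s := K) (μ := volume)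
  have iE : IntegrableOn (fun x => (u x ^ (p + 1) + lap u x ^ 2) * η x ^ 2) K volume :=
    hInt (by fun_prop)
  rw [integral_sub (hInt continuous_const) (iE.const_mul _), integral_const_mul, setIntegral_const,
    smul_eq_mul] at I5
  have I6 : ∫ x in K, (u x ^ (p + 1) + lap u x ^ 2) * η x ^ 2 ≤ 4 / θ * D * volume.real K := by
    rw [show 4 / θ * D * volume.real K = (volume.real K * D) / (θ / 4) by field_simp,
      le_div_iff₀ (by positivity)]
    linarith
  have I7 : ∫ x in Metric.closedBall 0 r, (u x ^ 2 + lap u x ^ 2) ≤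
      ∫ x in Metric.closedBall 0 r, (1 + (u x ^ (p + 1) + lap u x ^ 2) * η x ^ 2) := by
    refine setIntegral_mono_on ((hInt (by fun_prop)).mono_set hballK)
      ((hInt (by fun_prop)).mono_set hballK) measurableSet_closedBall fun x hx => ?_
    have hηx : η x = 1 := by
      simp only [hη, hζ1 x (by linarith [mem_closedBall_zero_iff.1 hx]), one_pow]
    have hux := hu.pos x
    have : u x ^ 2 ≤ 1 + u x ^ (p + 1) := by
      rcases le_total (u x) 1 with h | h
      · have h1 : u x ^ 2 ≤ 1 := pow_le_one₀ hux.le h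
        have h2 := (Real.rpow_pos_of_pos hux (p + 1)).le
        linarith
      · have h1 : u x ^ ((2 : ℕ) : ℝ) ≤ u x ^ (p + 1) :=
          Real.rpow_le_rpow_of_exponent_le h (by push_cast; linarith)
        rw [Real.rpow_natCast] at h1
        linarith
    rw [hηx]
    linarith
  have I8 : ∫ x in Metric.closedBall 0 r, (1 + (u x ^ (p + 1) + lap u x ^ 2) * η x ^ 2) ≤
      ∫ x in K, (1 + (u x ^ (p + 1) + lap u x ^ 2) * η x ^ 2) := by
    refine setIntegral_mono_set (hInt (by fun_prop)) (.of_forall fun x => ?_) hballK.eventuallyLE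
    have := (Real.rpow_pos_of_pos (hu.pos x) (p + 1)).le
    simp only [Pi.zero_apply]
    positivity
  rw [integral_add (hInt continuous_const) iE, setIntegral_const, smul_eq_mul] at I8
  linarith

/-- Local energy bounds which do not depend on the stable solution. -/
lemma exists_local_bound (hp : 1 < p) {r : ℝ} (hr : 0 < r) :
    ∃ C, ∀ u : EuclideanSpace ℝ (Fin n) → ℝ, IsStableSolution p u →
      ∫ x in Metric.closedBall 0 r, (u x ^ 2 + lap u x ^ 2 + gradDot u u x) ≤ C := by
  obtain ⟨ζ, hζ, hζc, hζ0, hζ1⟩ := exists_cutoff (n := n) hr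
  obtain ⟨r', hr', hζr'⟩ : ∃ r' > r, tsupport ζ ⊆ Metric.closedBall 0 r' := by
    obtain ⟨s, hs⟩ := hζc.isCompact.isBounded.subset_closedBall 0
    exact ⟨max s (r + 1), by simp, hs.trans (Metric.closedBall_subset_closedBall (le_max_left _ _))⟩
  obtain ⟨C, hC⟩ := exists_bound_sq (n := n) hp (hr.trans hr')
  set K : Set (EuclideanSpace ℝ (Fin n)) := Metric.closedBall 0 r' with hKdef
  have hK : IsCompact K := isCompact_closedBall _ _
  have hζ2 : ContDiff ℝ 2 ζ := contDiff_of_smooth hζ 2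
  obtain ⟨A, hA⟩ := hK.exists_bound_of_continuousOn (continuous_lap hζ2).continuousOn
  refine ⟨(max A 0 + 3) * C, fun u hu => ?_⟩
  have hu2 : ContDiff ℝ 2 u := hu.contDiff.of_le (by norm_num)
  have hInt : ∀ {F : EuclideanSpace ℝ (Fin n) → ℝ}, Continuous F → IntegrableOn F K volume :=
    fun hF => hF.continuousOn.integrableOn_compact hK
  have hballK : Metric.closedBall 0 r ⊆ K := Metric.closedBall_subset_closedBall hr'.le
  have I1 := setIntegral_green (hu2.mul hu2) hζ2 hK hζr'
  have cu := hu2.continuous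
  have cb := continuous_lap hu2
  have cζ := hζ2.continuous
  have cG := continuous_gradDot (hu2.of_le one_le_two) (hu2.of_le one_le_two)
  have c4 := continuous_lap hζ2
  have c5 := continuous_lap (hu2.mul hu2)
  have iN : IntegrableOn (fun x => u x * u x * lap ζ x - lap (fun y => u y * u y) x * ζ x) K volume :=
    hInt (by fun_prop)
  have iE : IntegrableOn (fun x => u x ^ 2 + lap u x ^ 2) K volume := hInt (by fun_prop)
  have I2 : ∫ x in Metric.closedBall 0 r, (u x ^ 2 + lap u x ^ 2 + gradDot u u x) ≤
      ∫ x in Metric.closedBall 0 r, (u x ^ 2 + lap u x ^ 2 + 2 * (gradDot u u x * ζ x)) := by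
    refine setIntegral_mono_on ((hInt (by fun_prop)).mono_set hballK)
      ((hInt (by fun_prop)).mono_set hballK) measurableSet_closedBall fun x hx => ?_
    rw [hζ1 x (by linarith [mem_closedBall_zero_iff.1 hx])]
    linarith [gradDot_self_nonneg (f := u) x]
  have I3 : ∫ x in Metric.closedBall 0 r, (u x ^ 2 + lap u x ^ 2 + 2 * (gradDot u u x * ζ x)) ≤
      ∫ x in K, (u x ^ 2 + lap u x ^ 2 + 2 * (gradDot u u x * ζ x)) := by
    refine setIntegral_mono_set (hInt (by fun_prop)) (.of_forall fun x => ?_) hballK.eventuallyLE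
    have := gradDot_self_nonneg (f := u) x
    have := (hζ0 x).1
    simp only [Pi.zero_apply]
    positivity
  have I4 : ∫ x in K, (u x ^ 2 + lap u x ^ 2 + 2 * (gradDot u u x * ζ x)) ≤
      ∫ x in K, ((max A 0 + 3) * (u x ^ 2 + lap u x ^ 2)
        - (u x * u x * lap ζ x - lap (fun y => u y * u y) x * ζ x)) := by
    refine setIntegral_mono_on (hInt (by fun_prop)) (hInt (by fun_prop)) hK.measurableSet
      fun x hx => ?_
    have h1 : lap ζ x ≤ max A 0 := ((le_abs_self _).trans (hA x hx)).trans (le_max_left _ _)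
    have h2 := mul_le_mul_of_nonneg_left h1 (sq_nonneg (u x))
    have h3 : 0 ≤ max A 0 * lap u x ^ 2 := mul_nonneg (le_max_right _ _) (sq_nonneg _)
    have h4 : -(2 * (u x * lap u x)) * ζ x ≤ u x ^ 2 + lap u x ^ 2 := by
      have h5 : -(2 * (u x * lap u x)) ≤ u x ^ 2 + lap u x ^ 2 := by
        nlinarith [sq_nonneg (u x + lap u x)]
      have h6 := mul_le_mul_of_nonneg_right h5 (hζ0 x).1
      have h7 := mul_le_mul_of_nonneg_left (hζ0 x).2
        (by positivity : 0 ≤ u x ^ 2 + lap u x ^ 2)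
      linarith
    rw [lap_mul hu2 hu2]
    nlinarith [sq_nonneg (u x), sq_nonneg (lap u x)]
  rw [integral_sub (iE.const_mul _) iN, I1, integral_const_mul, sub_zero] at I4
  have I5 := mul_le_mul_of_nonneg_left (hC u hu) (by positivity : 0 ≤ max A 0 + 3)
  linarith

end IsStableSolution

lemma fderiv_apply_eq_sum (f : EuclideanSpace ℝ (Fin n) → ℝ) (x y : EuclideanSpace ℝ (Fin n)) :
    fderiv ℝ f x y = ∑ i, y i * partialDeriv i f x := by
  conv_lhs => rw [← (EuclideanSpace.basisFun (Fin n) ℝ).sum_repr y]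
  simp [partialDeriv]

lemma hasDerivAt_integral_max (t : ℝ) :
    HasDerivAt (fun t => ∫ s in (0 : ℝ)..t, max s 0) (max t 0) t :=
  (continuous_id.max continuous_const).integral_hasStrictDerivAt 0 t |>.hasDerivAt

/-- A radial weight `w` which is, up to the factor `-y`, the gradient of a compactly supported
nonnegative function. -/
lemma exists_radial_weight (n : ℕ) :
    ∃ W w : EuclideanSpace ℝ (Fin n) → ℝ, ContDiff ℝ 1 W ∧ HasCompactSupport W ∧ (∀ y, 0 ≤ W y) ∧
      Continuous w ∧ (∀ y, 0 ≤ w y ∧ w y ≤ 1) ∧ (∀ y, 1 ≤ ‖y‖ → w y = 0) ∧ 0 < ∫ y, w y ∧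
      ∀ i y, partialDeriv i W y = -(y i * w y) := by
  set F : ℝ → ℝ := fun t => ∫ s in (0 : ℝ)..t, max s 0 with hF
  have hF' : ∀ t, HasDerivAt F (max t 0) t := hasDerivAt_integral_max
  have hF1 : ContDiff ℝ 1 F := by
    rw [contDiff_one_iff_deriv]
    refine ⟨fun t => (hF' t).differentiableAt, ?_⟩
    rw [funext fun t => (hF' t).deriv]
    exact continuous_id.max continuous_const
  have hF0 : ∀ t, t ≤ 0 → F t = 0 := fun t ht => by
    rw [hF]
    simp only
    rw [intervalIntegral.integral_congr (g := fun _ => 0)]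
    · simp
    · intro s hs
      rw [Set.uIcc_of_ge ht] at hs
      exact max_eq_right hs.2
  have hFnn : ∀ t, 0 ≤ F t := fun t => by
    rcases le_total t 0 with ht | ht
    · exact (hF0 t ht).ge
    · exact intervalIntegral.integral_nonneg ht fun s _ => le_max_right _ _
  have hW1 : ContDiff ℝ 1 fun y : EuclideanSpace ℝ (Fin n) => (1 - ‖y‖ ^ 2) / 2 :=
    (contDiff_const.sub (contDiff_norm_sq ℝ)).div_const _
  have hw : Continuous fun y : EuclideanSpace ℝ (Fin n) => max ((1 - ‖y‖ ^ 2) / 2) 0 := by fun_prop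
  have hw0 : ∀ y : EuclideanSpace ℝ (Fin n), 1 ≤ ‖y‖ → (1 - ‖y‖ ^ 2) / 2 ≤ 0 := fun y hy => by
    nlinarith
  have hwc : HasCompactSupport fun y : EuclideanSpace ℝ (Fin n) => max ((1 - ‖y‖ ^ 2) / 2) 0 :=
    HasCompactSupport.intro (isCompact_closedBall 0 1) fun y hy => by
      rw [mem_closedBall_zero_iff, not_le] at hy
      exact max_eq_right (hw0 y hy.le)
  refine ⟨fun y => F ((1 - ‖y‖ ^ 2) / 2), fun y => max ((1 - ‖y‖ ^ 2) / 2) 0, hF1.comp hW1,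
    HasCompactSupport.intro (isCompact_closedBall 0 1) fun y hy => ?_, fun y => hFnn _, hw,
    fun y => ⟨le_max_right _ _, max_le (by nlinarith [sq_nonneg ‖y‖]) zero_le_one⟩,
    fun y hy => max_eq_right (hw0 y hy), ?_, fun i y => ?_⟩
  · rw [mem_closedBall_zero_iff, not_le] at hy
    exact hF0 _ (hw0 y hy.le)
  · refine hw.integral_pos_of_hasCompactSupport_nonneg_nonzero hwc (fun y => le_max_right _ _)
      (x := 0) ?_
    norm_num
  · rw [partialDeriv_comp (F := F) (F' := fun t => max t 0)
      (hW1.differentiable (by norm_num)) (fun y => hF' _)]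
    have : HasFDerivAt (fun y : EuclideanSpace ℝ (Fin n) => (1 - ‖y‖ ^ 2) / 2)
        ((2 : ℝ)⁻¹ • -((2 : ℝ) • innerSL ℝ y)) y := by
      have h1 := ((hasStrictFDerivAt_norm_sq y).hasFDerivAt.const_sub 1).const_mul (2⁻¹ : ℝ)
      have h2 : (fun y : EuclideanSpace ℝ (Fin n) => (1 - ‖y‖ ^ 2) / 2) =
          fun y => 2⁻¹ * (1 - ‖y‖ ^ 2) := by
        funext z
        ring
      rw [h2]
      exact_mod_cast h1
    simp only [partialDeriv, this.fderiv]
    simp [EuclideanSpace.inner_single_right]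
    ring

/-- A weighted mean value inequality for subharmonic functions. -/
lemma mul_integral_le_integral_mul {W w : EuclideanSpace ℝ (Fin n) → ℝ} (hW : ContDiff ℝ 1 W)
    (hWc : HasCompactSupport W) (hW0 : ∀ y, 0 ≤ W y) (hw : Continuous w)
    (hw1 : ∀ y, 1 ≤ ‖y‖ → w y = 0) (hWw : ∀ i y, partialDeriv i W y = -(y i * w y))
    (hg : ContDiff ℝ 2 g) (hg0 : ∀ x, 0 ≤ lap g x) :
    g 0 * ∫ y, w y ≤ ∫ y, g y * w y := by
  have hwc : HasCompactSupport w := HasCompactSupport.intro (isCompact_closedBall 0 1) fun y hy => by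
    rw [mem_closedBall_zero_iff, not_le] at hy
    exact hw1 y hy.le
  have hg1 : Differentiable ℝ g := hg.differentiable (by norm_num)
  have cg := hg.continuous
  have cg' : Continuous (fderiv ℝ g) := hg.continuous_fderiv (by norm_num)
  obtain ⟨B, hB⟩ := (isCompact_closedBall (0 : EuclideanSpace ℝ (Fin n)) 2).exists_bound_of_continuousOn
    cg'.continuousOn
  have hInt : ∀ r : ℝ, Integrable fun y => g (r • y) * w y := fun r =>
    (Continuous.mul (by fun_prop) hw).integrable_of_hasCompactSupport hwc.mul_left
  have hderiv : ∀ r ∈ Set.Ioo (0 : ℝ) 1, HasDerivAt (fun r : ℝ => ∫ y, g (r • y) * w y)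
      (∫ y, fderiv ℝ g (r • y) y * w y) r := fun r hr => by
    refine (hasDerivAt_integral_of_dominated_loc_of_deriv_le (bound := fun y => B * |w y|)
      (F' := fun r y => fderiv ℝ g (r • y) y * w y) (Metric.ball_mem_nhds r one_pos)
      (.of_forall fun r => (hInt r).aestronglyMeasurable) (hInt r) ?_ (.of_forall fun y s hs => ?_)
      ?_ (.of_forall fun y s hs => ?_)).2
    · exact Continuous.aestronglyMeasurable (by fun_prop)
    · rw [norm_mul, Real.norm_eq_abs (w y)]
      by_cases hy : 1 ≤ ‖y‖
      · simp [hw1 y hy]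
      · push Not at hy
        refine mul_le_mul_of_nonneg_right ?_ (abs_nonneg _)
        have hs2 : |s| ≤ 2 := by
          rw [Metric.mem_ball, Real.dist_eq] at hs
          have := abs_sub_abs_le_abs_sub s r
          rw [abs_of_pos hr.1] at this
          linarith [hr.2]
        have h1 := hB (s • y) (by
          rw [mem_closedBall_zero_iff, norm_smul, Real.norm_eq_abs]
          nlinarith [norm_nonneg y, abs_nonneg s])
        calc _ ≤ ‖fderiv ℝ g (s • y)‖ * ‖y‖ := ContinuousLinearMap.le_opNorm _ _
          _ ≤ ‖fderiv ℝ g (s • y)‖ * 1 := mul_le_mul_of_nonneg_left hy.le (norm_nonneg _)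
          _ ≤ B := by rwa [mul_one]
    · exact (hw.abs.integrable_of_hasCompactSupport hwc.norm).const_mul B
    · have h1 : HasDerivAt (fun s : ℝ => s • y) y s := by
        simpa using (hasDerivAt_id s).smul_const y
      exact ((hg1 (s • y)).hasFDerivAt.comp_hasDerivAt s h1).mul_const (w y)
  have hnonneg : ∀ r ∈ Set.Ioo (0 : ℝ) 1, 0 ≤ ∫ y, fderiv ℝ g (r • y) y * w y := fun r hr => by
    have hG : ContDiff ℝ 2 fun y => g (0 + r • y) := contDiff_comp_affine hg 0 r
    have h1 := integral_gradDot hW hG (Or.inl hWc)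
    have h2 : ∫ y, gradDot W (fun y => g (0 + r • y)) y =
        -(r * ∫ y, fderiv ℝ g (r • y) y * w y) := by
      rw [← integral_const_mul, ← integral_neg]
      refine integral_congr_ae (.of_forall fun y => ?_)
      simp only [gradDot, partialDeriv_comp_affine hg1 0 r, hWw, fderiv_apply_eq_sum]
      simp only [zero_add, Finset.sum_mul, Finset.mul_sum, ← Finset.sum_neg_distrib]
      exact Finset.sum_congr rfl fun i _ => by ring
    rw [h2, neg_inj, lap_comp_affine hg] at h1
    have h3 : 0 ≤ r * ∫ y, fderiv ℝ g (r • y) y * w y := by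
      rw [h1]
      exact integral_nonneg fun y => mul_nonneg (hW0 y) (mul_nonneg (sq_nonneg r) (hg0 _))
    exact nonneg_of_mul_nonneg_right h3 hr.1
  have hcont : ContinuousOn (fun r : ℝ => ∫ y, g (r • y) * w y) (Set.Icc 0 1) := by
    obtain ⟨B', hB'⟩ := (isCompact_closedBall (0 : EuclideanSpace ℝ (Fin n)) 1).exists_bound_of_continuousOn
      cg.continuousOn
    refine continuousOn_of_dominated (bound := fun y => B' * |w y|)
      (fun r _ => (hInt r).aestronglyMeasurable) (fun r hr => .of_forall fun y => ?_)
      ((hw.abs.integrable_of_hasCompactSupport hwc.norm).const_mul B')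
      (.of_forall fun y => Continuous.continuousOn (by fun_prop))
    rw [norm_mul, Real.norm_eq_abs (w y)]
    by_cases hy : 1 ≤ ‖y‖
    · simp [hw1 y hy]
    · push Not at hy
      refine mul_le_mul_of_nonneg_right (hB' _ ?_) (abs_nonneg _)
      rw [mem_closedBall_zero_iff, norm_smul, Real.norm_eq_abs, abs_of_nonneg hr.1]
      nlinarith [norm_nonneg y, hr.1, hr.2]
  have hmono := monotoneOn_of_deriv_nonneg (convex_Icc (0 : ℝ) 1) hcont
    (by
      rw [interior_Icc]
      exact fun r hr => (hderiv r hr).differentiableAt.differentiableWithinAt)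
    (by
      rw [interior_Icc]
      exact fun r hr => (hderiv r hr).deriv ▸ hnonneg r hr)
    (Set.left_mem_Icc.2 zero_le_one) (Set.right_mem_Icc.2 zero_le_one) zero_le_one
  simpa [integral_const_mul] using hmono

namespace IsStableSolution

variable {p : ℝ} {u : EuclideanSpace ℝ (Fin n) → ℝ}

/-- Stable solutions are superharmonic. -/
lemma lap_nonpos (hu : IsStableSolution p u) (hp : 1 < p) (x₀ : EuclideanSpace ℝ (Fin n)) :
    lap u x₀ ≤ 0 := by
  obtain ⟨W, w, hW, hWc, hW0, hw, hw01, hw1, hwpos, hWw⟩ := exists_radial_weight n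
  obtain ⟨C, hC⟩ := exists_bound_sq (n := n) hp one_pos
  have hp1 : 0 < p - 1 := by linarith
  set K : Set (EuclideanSpace ℝ (Fin n)) := Metric.closedBall 0 1 with hKdef
  have hK : IsCompact K := isCompact_closedBall _ _
  have key : ∀ U : EuclideanSpace ℝ (Fin n) → ℝ, IsStableSolution p U →
      lap U 0 * ∫ y, w y ≤ volume.real K + C := fun U hU => by
    have hU2 : ContDiff ℝ 2 U := hU.contDiff.of_le (by norm_num)
    have hlU : ContDiff ℝ 2 (lap U) := contDiff_lap hU.contDiff (by norm_num)
    have c1 := hU2.continuous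
    have c2 := hlU.continuous
    have hInt : ∀ {F : EuclideanSpace ℝ (Fin n) → ℝ}, Continuous F → IntegrableOn F K volume :=
      fun hF => hF.continuousOn.integrableOn_compact hK
    have h1 := mul_integral_le_integral_mul hW hWc hW0 hw hw1 hWw hlU fun x => by
      rw [hU.lap_lap]
      exact (Real.rpow_pos_of_pos (hU.pos x) p).le
    have h2 : ∫ y, lap U y * w y = ∫ y in K, lap U y * w y := by
      refine (setIntegral_eq_integral_of_forall_compl_eq_zero fun y hy => ?_).symm
      rw [mem_closedBall_zero_iff, not_le] at hy
      rw [hw1 y hy.le, mul_zero]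
    have h3 : ∫ y in K, lap U y * w y ≤ ∫ y in K, (1 + (U y ^ 2 + lap U y ^ 2)) := by
      refine setIntegral_mono (hInt (by fun_prop)) (hInt (by fun_prop)) fun y => ?_
      obtain ⟨b1, b2⟩ := hw01 y
      nlinarith [sq_nonneg (lap U y - w y), sq_nonneg (lap U y), sq_nonneg (U y)]
    rw [integral_add (hInt continuous_const) (hInt (by fun_prop)), setIntegral_const, smul_eq_mul,
      mul_one] at h3
    linarith [hC U hU]
  by_contra! hpos
  set I := ∫ y, w y with hI
  have hq : 0 < 4 / (p - 1) := by positivity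
  have ht : Tendsto (fun R : ℝ => R ^ (4 / (p - 1)) * (lap u x₀ * I)) atTop atTop :=
    (tendsto_rpow_atTop hq).atTop_mul_const (by positivity)
  obtain ⟨R, hR, hR1⟩ := ((ht.eventually_gt_atTop (volume.real K + C)).and
    (eventually_ge_atTop 1)).exists
  have hu2 : ContDiff ℝ 2 u := hu.contDiff.of_le (by norm_num)
  have h1 := key _ (hu.rescale hp x₀ (zero_lt_one.trans_le hR1))
  rw [lap_const_mul (contDiff_comp_affine hu2 x₀ R), lap_comp_affine hu2] at h1
  simp only [smul_zero, add_zero] at h1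
  have h2 : 0 < R ^ (4 / (p - 1)) * (lap u x₀ * I) :=
    mul_pos (Real.rpow_pos_of_pos (by linarith) _) (by positivity)
  nlinarith [mul_nonneg (sub_nonneg.2 (one_le_pow₀ hR1 : 1 ≤ R ^ 2)) h2.le]

end IsStableSolution

lemma exists_cutoff_tsupport_subset {r : ℝ} (hr : 0 < r) :
    ∃ (ζ : EuclideanSpace ℝ (Fin n) → ℝ) (r' : ℝ), ContDiff ℝ (⊤ : ℕ∞) ζ ∧ r < r' ∧
      tsupport ζ ⊆ Metric.closedBall 0 r' ∧
      (∀ x, 0 ≤ ζ x ∧ ζ x ≤ 1) ∧ ∀ x, ‖x‖ < r + 1 → ζ x = 1 := by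
  obtain ⟨ζ, hζ, hζc, hζ0, hζ1⟩ := exists_cutoff (n := n) hr
  obtain ⟨s, hs⟩ := hζc.isCompact.isBounded.subset_closedBall 0
  exact ⟨ζ, max s (r + 1), hζ, by simp,
    hs.trans (Metric.closedBall_subset_closedBall (le_max_left _ _)), hζ0, hζ1⟩

lemma localized_lap_sq_le {M a b G s σ l d : ℝ} (hG : 0 ≤ G) (hs : s ^ 2 ≤ G * d) (hM : 1 ≤ M)
    (hl : |l| ≤ M) (hd : |d| ≤ M) (hσ : 0 ≤ σ ∧ σ ≤ 1) :
    (a * l + 2 * s + σ * b) ^ 2 ≤ 12 * (M ^ 2 * (a ^ 2 + b ^ 2 + G)) := by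
  have f1 : ∀ x y z : ℝ, (x + 2 * y + z) ^ 2 ≤ 3 * (x ^ 2 + 4 * y ^ 2 + z ^ 2) := fun x y z => by
    nlinarith [sq_nonneg (x - 2 * y), sq_nonneg (x - z), sq_nonneg (2 * y - z)]
  have f2 : (a * l) ^ 2 ≤ M ^ 2 * a ^ 2 := by
    have := mul_le_mul_of_nonneg_left (sq_le_sq' (abs_le.1 hl).1 (abs_le.1 hl).2) (sq_nonneg a)
    rw [mul_pow]
    linarith
  have f3 : G * d ≤ M ^ 2 * G := by
    have h1 : d ≤ M ^ 2 := ((le_abs_self d).trans hd).trans (le_self_pow₀ hM two_ne_zero)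
    linarith [mul_le_mul_of_nonneg_left h1 hG]
  have f4 : (σ * b) ^ 2 ≤ M ^ 2 * b ^ 2 := by
    rw [mul_pow]
    exact mul_le_mul_of_nonneg_right (pow_le_pow_left₀ hσ.1 (hσ.2.trans hM) 2) (sq_nonneg b)
  have f5 : 0 ≤ M ^ 2 * a ^ 2 := by positivity
  have f6 : 0 ≤ M ^ 2 * b ^ 2 := by positivity
  linarith [f1 (a * l) s (σ * b)]

lemma weighted_energy_pointwise {p t A M a b q w G Γ g s ξ η σ h L l d : ℝ} (ht : 0 ≤ t)
    (htA : t * (p - 1) = 4 * A) (hb : b ≤ 0) (hq : 0 ≤ q) (hp : 0 ≤ p) (ha : 0 ≤ a) (hG : 0 ≤ G)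
    (hg : g ^ 2 ≤ Γ * ξ) (hs : s ^ 2 ≤ G * d) (hξ : ξ ≤ A * η) (hM : 1 ≤ M) (hh : |h| ≤ M)
    (hL : |L| ≤ M) (hl : |l| ≤ M) (hd : |d| ≤ M) (hσ : 0 ≤ σ ∧ σ ≤ 1) :
    ((b * h + 2 * g + η * q) ^ 2 - 2 * t * (b * (b * h + 2 * g + η * q))
        + t ^ 2 * (a * l + 2 * s + σ * b) ^ 2
        - p * (w * a * (b * η) ^ 2 - 2 * t * (b * η * q) + t ^ 2 * (q * a * σ ^ 2)))
      - (q * (b * (2 * η * h + 2 * ξ) + 4 * η * g + η ^ 2 * q)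
        - (p * (w * a) * b + p * (p - 1) * w * G) * (b * η ^ 2))
      + 3 * (b ^ 2 * L - (2 * Γ + 2 * (b * q)) * ξ) ≤
    (8 + 2 * t + 16 * t ^ 2) * M ^ 2 * (a ^ 2 + b ^ 2 + G)
      - p * (p - 1) * (w * G * -b * η ^ 2) := by
  have hMM : M ≤ M ^ 2 := by nlinarith
  have sq_le : ∀ {z : ℝ}, |z| ≤ M → z ^ 2 ≤ M ^ 2 := fun hz =>
    sq_le_sq' (abs_le.1 hz).1 (abs_le.1 hz).2
  have hb2 := sq_nonneg b
  have e1 : 4 * (b * h * g) ≤ g ^ 2 + 4 * (b ^ 2 * h ^ 2) := by nlinarith [sq_nonneg (g - 2 * b * h)]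
  have e2 : -(4 * (t * b * g)) ≤ g ^ 2 + 4 * t ^ 2 * b ^ 2 := by
    nlinarith [sq_nonneg (g + 2 * t * b)]
  have e3 : 0 ≤ -b * q * (8 * (A * η - ξ)) :=
    mul_nonneg (mul_nonneg (by linarith) hq) (by linarith)
  have e4 : b ^ 2 * h ^ 2 ≤ M ^ 2 * b ^ 2 := by nlinarith [mul_le_mul_of_nonneg_left (sq_le hh) hb2]
  have e5 : b ^ 2 * L ≤ M ^ 2 * b ^ 2 := by
    nlinarith [mul_le_mul_of_nonneg_left (((le_abs_self L).trans hL).trans hMM) hb2]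
  have e6 : -(t * (b ^ 2 * h)) ≤ t * (M ^ 2 * b ^ 2) := by
    have : -h ≤ M ^ 2 := ((neg_le_abs h).trans hh).trans hMM
    nlinarith [mul_le_mul_of_nonneg_left this (mul_nonneg ht hb2)]
  have e7 : t ^ 2 * b ^ 2 ≤ t ^ 2 * (M ^ 2 * b ^ 2) := by
    have : b ^ 2 ≤ M ^ 2 * b ^ 2 := by nlinarith
    exact mul_le_mul_of_nonneg_left this (sq_nonneg t)
  have e8 := localized_lap_sq_le hG hs hM hl hd hσ (a := a) (b := b)
  have e9 := mul_le_mul_of_nonneg_left e8 (sq_nonneg t)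
  have e10 : 0 ≤ p * t ^ 2 * (q * a * σ ^ 2) := by positivity
  have e11 : 0 ≤ (8 + 2 * t + 4 * t ^ 2) * (M ^ 2 * (a ^ 2 + G)) := by positivity
  have e12 : t * (p - 1) * (b * η * q) = 4 * A * (b * η * q) := by rw [htA]
  linarith

namespace IsStableSolution

variable {p : ℝ}

/-- A local bound for a weighted gradient term which does not depend on the stable solution. -/
lemma exists_weighted_gradient_bound (hp : 1 < p) :
    ∃ C, ∀ u : EuclideanSpace ℝ (Fin n) → ℝ, IsStableSolution p u →
      ∫ x in Metric.closedBall 0 1, u x ^ (p - 2) * gradDot u u x * -lap u x ≤ C := by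
  obtain ⟨ζ, r₁, hζ, hr₁, hζr, hζ0, hζ1⟩ := exists_cutoff_tsupport_subset (n := n) one_pos
  obtain ⟨σ, r₂, hσ, hr₂, hσr, hσ0, hσ1⟩ :=
    exists_cutoff_tsupport_subset (n := n) (one_pos.trans hr₁)
  obtain ⟨C, hC⟩ := exists_local_bound (n := n) hp (one_pos.trans (hr₁.trans hr₂))
  have hp1 : 0 < p - 1 := by linarith
  set K : Set (EuclideanSpace ℝ (Fin n)) := Metric.closedBall 0 r₂ with hKdef
  have hK : IsCompact K := isCompact_closedBall _ _
  have hζK : tsupport ζ ⊆ K := hζr.trans (Metric.closedBall_subset_closedBall hr₂.le)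
  have hballK : Metric.closedBall 0 1 ⊆ K :=
    Metric.closedBall_subset_closedBall (hr₁.trans hr₂).le
  have hζ1' : Differentiable ℝ ζ := hζ.differentiable (by simp)
  have hζ2 : ContDiff ℝ 2 ζ := contDiff_of_smooth hζ 2
  have hσ2 : ContDiff ℝ 2 σ := contDiff_of_smooth hσ 2
  set η : EuclideanSpace ℝ (Fin n) → ℝ := fun x => ζ x ^ (1 + 1) with hη
  have hηs : ContDiff ℝ (⊤ : ℕ∞) η := hζ.pow _
  have hη2 : ContDiff ℝ 2 η := contDiff_of_smooth hηs 2
  have hη3 : ContDiff ℝ 3 η := contDiff_of_smooth hηs 3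
  have hηζ : tsupport η ⊆ tsupport ζ := closure_mono fun x hx => by
    contrapose! hx
    simp [hη, Function.notMem_support.1 hx]
  have hsub : ∀ F : EuclideanSpace ℝ (Fin n) → ℝ, (∀ x, η x = 0 → F x = 0) →
      tsupport F ⊆ tsupport ζ :=
    fun F hF => (closure_mono fun x hx => by contrapose! hx; simpa using hF x (by simpa using hx)).trans hηζ
  have hξ2 : ContDiff ℝ 2 (gradDot η η) := contDiff_gradDot hη3 hη3 (by norm_num)
  have hξK : tsupport (gradDot η η) ⊆ K := by
    refine closure_minimal (fun x hx => ?_) hK.isClosed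
    by_contra h
    exact hx (gradDot_eq_zero_of_notMem_tsupport fun h' => h (hζK (hηζ h')))
  have cdζ : Continuous (gradDot ζ ζ) :=
    continuous_gradDot (hζ2.of_le (by norm_num)) (hζ2.of_le (by norm_num))
  have cdσ : Continuous (gradDot σ σ) :=
    continuous_gradDot (hσ2.of_le (by norm_num)) (hσ2.of_le (by norm_num))
  obtain ⟨A₀, hA₀⟩ := hK.exists_bound_of_continuousOn cdζ.continuousOn
  obtain ⟨M₁, hM₁⟩ := hK.exists_bound_of_continuousOn (continuous_lap hη2).continuousOn
  obtain ⟨M₂, hM₂⟩ := hK.exists_bound_of_continuousOn (continuous_lap hξ2).continuousOn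
  obtain ⟨M₃, hM₃⟩ := hK.exists_bound_of_continuousOn (continuous_lap hσ2).continuousOn
  obtain ⟨M₄, hM₄⟩ := hK.exists_bound_of_continuousOn cdσ.continuousOn
  set A := 4 * max A₀ 0 with hA
  have hA0 : 0 ≤ A := mul_nonneg (by norm_num) (le_max_right _ _)
  set M := max (max M₁ M₂) (max (max M₃ M₄) 1) with hM
  set t := 4 * A / (p - 1) with ht
  have ht0 : 0 ≤ t := by positivity
  have htA : t * (p - 1) = 4 * A := div_mul_cancel₀ _ hp1.ne'
  refine ⟨(8 + 2 * t + 16 * t ^ 2) * M ^ 2 * C / (p * (p - 1)), fun u hu => ?_⟩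
  have hu2 : ContDiff ℝ 2 u := hu.contDiff.of_le (by norm_num)
  set b := lap u with hbdef
  have hb2 : ContDiff ℝ 2 b := contDiff_lap hu.contDiff (by norm_num)
  have hq2 : ContDiff ℝ 2 fun x => u x ^ p := (hu.contDiff_rpow p).of_le (by norm_num)
  have hInt : ∀ {F : EuclideanSpace ℝ (Fin n) → ℝ}, Continuous F → IntegrableOn F K volume :=
    fun hF => hF.continuousOn.integrableOn_compact hK
  have hη22 : ContDiff ℝ 2 fun x => η x * η x := hη2.mul hη2
  have hbη : ContDiff ℝ 2 fun x => b x * η x := hb2.mul hη2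
  have huσ : ContDiff ℝ 2 fun x => u x * σ x := hu2.mul hσ2
  have htuσ : ContDiff ℝ 2 fun x => -t * (u x * σ x) := contDiff_const.mul huσ
  have hφ : ContDiff ℝ 2 fun x => b x * η x + -t * (u x * σ x) := hbη.add htuσ
  have hφK : tsupport (fun x => b x * η x + -t * (u x * σ x)) ⊆ K := by
    refine closure_minimal (fun x hx => ?_) hK.isClosed
    by_contra h
    refine hx ?_
    have h1 : ζ x = 0 := image_eq_zero_of_notMem_tsupport fun h' => h (hζK h')
    have h2 : σ x = 0 := image_eq_zero_of_notMem_tsupport fun h' => h (hσr h')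
    simp [hη, h1, h2]
  have I1 := hu.setIntegral_stable hφ hK hφK
  have I2 := setIntegral_green hq2 (hb2.mul hη22) hK
    ((hsub _ fun x hx => by simp [hx]).trans hζK)
  have I3 := setIntegral_green (hb2.mul hb2) hξ2 hK hξK
  have cu := hu2.continuous
  have cb := hb2.continuous
  have cη := hη2.continuous
  have cσ := hσ2.continuous
  have cw := (hu.contDiff_rpow (p - 1)).continuous
  have cw2 := (hu.contDiff_rpow (p - 2)).continuous
  have cq := hq2.continuous
  have cG := continuous_gradDot (hu2.of_le one_le_two) (hu2.of_le one_le_two)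
  have c1 := continuous_lap hφ
  have c2 := continuous_lap (hb2.mul hη22)
  have c3 := continuous_lap hq2
  have c4 := continuous_lap hξ2
  have c5 := continuous_lap (hb2.mul hb2)
  have c6 := hξ2.continuous
  set S : EuclideanSpace ℝ (Fin n) → ℝ := fun x =>
    lap (fun x => b x * η x + -t * (u x * σ x)) x ^ 2
      - p * (u x ^ (p - 1) * (b x * η x + -t * (u x * σ x)) ^ 2) with hS
  set N₁ : EuclideanSpace ℝ (Fin n) → ℝ := fun x =>
    u x ^ p * lap (fun y => b y * (η y * η y)) x
      - lap (fun x => u x ^ p) x * (b x * (η x * η x)) with hN₁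
  set N₂ : EuclideanSpace ℝ (Fin n) → ℝ := fun x =>
    b x * b x * lap (gradDot η η) x - lap (fun y => b y * b y) x * gradDot η η x with hN₂
  have iS : IntegrableOn S K volume := hInt (by fun_prop)
  have iN₁ : IntegrableOn N₁ K volume := hInt (by fun_prop)
  have iN₂ : IntegrableOn N₂ K volume := hInt (by fun_prop)
  have iSN : IntegrableOn (fun x => S x - N₁ x) K volume := iS.sub iN₁
  have I4 : 0 ≤ ∫ x in K, (S x - N₁ x + 3 * N₂ x) := by
    rw [integral_add iSN (iN₂.const_mul _), integral_sub iS iN₁, integral_const_mul, I2, I3]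
    linarith
  have hpt : ∀ x ∈ K, S x - N₁ x + 3 * N₂ x ≤
      (8 + 2 * t + 16 * t ^ 2) * M ^ 2 * (u x ^ 2 + b x ^ 2 + gradDot u u x)
        - p * (p - 1) * (u x ^ (p - 2) * gradDot u u x * -b x * η x ^ 2) := fun x hx => by
    have hux := hu.pos x
    have hw1 : u x ^ (p - 2) * u x = u x ^ (p - 1) := by
      rw [← Real.rpow_add_one hux.ne']
      ring_nf
    have hw2 : u x ^ (p - 2) * u x * u x = u x ^ p := by
      rw [hw1, ← Real.rpow_add_one hux.ne']
      ring_nf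
    have hη1 := hη2.differentiable (by norm_num)
    have hb1 := hb2.differentiable (by norm_num)
    have hξA : gradDot η η x ≤ A * η x := by
      have h1 : gradDot η η x = 4 * (gradDot ζ ζ x * ζ x ^ 2) := by
        rw [hη, gradDot_pow_self hζ1' 1]
        norm_num
        ring
      have h2 : gradDot ζ ζ x ≤ max A₀ 0 := ((le_abs_self _).trans (hA₀ x hx)).trans (le_max_left _ _)
      rw [h1, hA]
      have := mul_le_mul_of_nonneg_right h2 (sq_nonneg (ζ x))
      simp only [hη]
      norm_num
      linarith
    have e := weighted_energy_pointwise (t := t) (A := A) (M := M) (p := p) (a := u x) (b := b x)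
      (q := u x ^ p) (w := u x ^ (p - 2)) (G := gradDot u u x) (Γ := gradDot b b x)
      (g := gradDot b η x) (s := gradDot u σ x) (ξ := gradDot η η x) (η := η x) (σ := σ x)
      (h := lap η x) (L := lap (gradDot η η) x) (l := lap σ x) (d := gradDot σ σ x) ht0 htA
      (hu.lap_nonpos hp x) (Real.rpow_pos_of_pos hux p).le (by linarith) hux.le
      (gradDot_self_nonneg x) (gradDot_sq_le x) (gradDot_sq_le x) hξA (by simp [hM])
      ((hM₁ x hx).trans (by simp [hM])) ((hM₂ x hx).trans (by simp [hM]))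
      ((hM₃ x hx).trans (by simp [hM])) ((hM₄ x hx).trans (by simp [hM])) (hσ0 x)
    have l1 : lap (fun x => b x * η x) x = b x * lap η x + 2 * gradDot b η x + η x * u x ^ p := by
      rw [lap_mul hb2 hη2, hbdef, hu.lap_lap]
    have l2 : lap (fun x => u x * σ x) x = u x * lap σ x + 2 * gradDot u σ x + σ x * b x :=
      lap_mul hu2 hσ2 x
    have l3 : lap (fun y => b y * (η y * η y)) x =
        b x * (2 * η x * lap η x + 2 * gradDot η η x) + 4 * η x * gradDot b η x
          + η x ^ 2 * u x ^ p := by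
      have : gradDot b (fun x => η x * η x) x = 2 * η x * gradDot b η x := by
        rw [gradDot_comm, gradDot_mul_left hη1 hη1, gradDot_comm]
        ring
      rw [lap_mul hb2 hη22, lap_mul hη2 hη2, this, hbdef, hu.lap_lap]
      ring
    have l4 : lap (fun y => b y * b y) x = 2 * gradDot b b x + 2 * (b x * u x ^ p) := by
      rw [lap_mul hb2 hb2, hbdef, hu.lap_lap]
      ring
    have l5 : lap (fun x => b x * η x + -t * (u x * σ x)) x =
        lap (fun x => b x * η x) x - t * lap (fun x => u x * σ x) x := by
      rw [lap_add hbη htuσ, lap_const_mul huσ]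
      ring
    have cross : lap (fun x => b x * η x) x * lap (fun x => u x * σ x) x =
        b x * lap (fun x => b x * η x) x ∧ b x * η x * (u x * σ x) = b x * η x * u x := by
      by_cases hxζ : x ∈ tsupport ζ
      · have hx1 : ‖x‖ < r₁ + 1 := by linarith [mem_closedBall_zero_iff.1 (hζr hxζ)]
        have : (fun x => u x * σ x) =ᶠ[𝓝 x] u := by
          filter_upwards [(isOpen_lt continuous_norm continuous_const).mem_nhds hx1] with y hy
          rw [hσ1 y hy, mul_one]
        rw [lap_congr this, hσ1 x hx1]
        exact ⟨mul_comm _ _, by ring⟩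
      · have h0 : lap (fun x => b x * η x) x = 0 :=
          lap_eq_zero_of_notMem_tsupport fun h => hxζ (hsub _ (fun y hy => by simp [hy]) h)
        have h1 : η x = 0 := image_eq_zero_of_notMem_tsupport fun h => hxζ (hηζ h)
        rw [h0, h1]
        simp
    have r1 : S x = (b x * lap η x + 2 * gradDot b η x + η x * u x ^ p) ^ 2
        - 2 * t * (b x * (b x * lap η x + 2 * gradDot b η x + η x * u x ^ p))
        + t ^ 2 * (u x * lap σ x + 2 * gradDot u σ x + σ x * b x) ^ 2
        - p * (u x ^ (p - 2) * u x * (b x * η x) ^ 2 - 2 * t * (b x * η x * u x ^ p)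
          + t ^ 2 * (u x ^ p * u x * σ x ^ 2)) := by
      simp only [hS]
      rw [l5, ← l1, ← l2, ← cross.1, ← hw1, ← hw2]
      linear_combination (2 * t * p * u x ^ (p - 2) * u x) * cross.2
    have r2 : N₁ x = u x ^ p * (b x * (2 * η x * lap η x + 2 * gradDot η η x)
          + 4 * η x * gradDot b η x + η x ^ 2 * u x ^ p)
        - (p * (u x ^ (p - 2) * u x) * b x + p * (p - 1) * u x ^ (p - 2) * gradDot u u x)
          * (b x * η x ^ 2) := by
      simp only [hN₁]
      rw [l3, lap_rpow hu2 hu.pos, hw1]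
      ring
    have r3 : N₂ x = b x ^ 2 * lap (gradDot η η) x
        - (2 * gradDot b b x + 2 * (b x * u x ^ p)) * gradDot η η x := by
      simp only [hN₂]
      rw [l4]
      ring
    rw [r1, r2, r3]
    exact e
  have I5 := setIntegral_mono_on (hInt (by fun_prop)) (hInt (by fun_prop)) hK.measurableSet hpt
    (μ := volume)
  have iE : IntegrableOn (fun x => u x ^ (p - 2) * gradDot u u x * -b x * η x ^ 2) K volume :=
    hInt (by fun_prop)
  have iF : IntegrableOn (fun x => u x ^ 2 + b x ^ 2 + gradDot u u x) K volume :=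
    hInt (by fun_prop)
  rw [integral_sub (iF.const_mul _) (iE.const_mul _), integral_const_mul, integral_const_mul] at I5
  have I6 := mul_le_mul_of_nonneg_left (hC u hu)
    (by positivity : 0 ≤ (8 + 2 * t + 16 * t ^ 2) * M ^ 2)
  have hnn : ∀ x, 0 ≤ u x ^ (p - 2) * gradDot u u x * -b x := fun x =>
    mul_nonneg (mul_nonneg (Real.rpow_pos_of_pos (hu.pos x) _).le (gradDot_self_nonneg x))
      (neg_nonneg.2 (hu.lap_nonpos hp x))
  have I7 : ∫ x in Metric.closedBall 0 1, u x ^ (p - 2) * gradDot u u x * -b x ≤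
      ∫ x in Metric.closedBall 0 1, u x ^ (p - 2) * gradDot u u x * -b x * η x ^ 2 := by
    refine setIntegral_mono_on ((hInt (by fun_prop)).mono_set hballK)
      ((hInt (by fun_prop)).mono_set hballK) measurableSet_closedBall fun x hx => ?_
    have hηx : η x = 1 := by
      simp only [hη, hζ1 x (by linarith [mem_closedBall_zero_iff.1 hx]), one_pow]
    rw [hηx]
    linarith
  have I8 := setIntegral_mono_set iE
    (.of_forall fun x => mul_nonneg (hnn x) (sq_nonneg (η x))) hballK.eventuallyLE
  refine I7.trans (I8.trans ?_)
  rw [le_div_iff₀ (by positivity)]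
  linarith

end IsStableSolution

namespace IsStableSolution

variable {p : ℝ} {u : EuclideanSpace ℝ (Fin n) → ℝ}

lemma weighted_gradient_rescale (hu : IsStableSolution p u) (hp : 1 < p) {R : ℝ} (hR : 0 < R)
    (x : EuclideanSpace ℝ (Fin n)) :
    (fun U : EuclideanSpace ℝ (Fin n) → ℝ => U x ^ (p - 2) * gradDot U U x * -lap U x)
      (fun x => R ^ (4 / (p - 1)) * u (0 + R • x)) =
      (R ^ (4 / (p - 1))) ^ 2 * R ^ 8 *
        (u (R • x) ^ (p - 2) * gradDot u u (R • x) * -lap u (R • x)) := by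
  have hu2 : ContDiff ℝ 2 u := hu.contDiff.of_le (by norm_num)
  have hu1 : Differentiable ℝ u := hu2.differentiable (by norm_num)
  have hA : 0 < R ^ (4 / (p - 1)) := Real.rpow_pos_of_pos hR _
  have hA1 : (R ^ (4 / (p - 1))) ^ (p - 2) * R ^ (4 / (p - 1)) = R ^ 4 := by
    rw [← Real.rpow_add_one hA.ne', ← Real.rpow_mul hR.le, show p - 2 + 1 = p - 1 by ring,
      div_mul_cancel₀ _ (by linarith)]
    exact_mod_cast Real.rpow_natCast R 4
  have hc := contDiff_comp_affine hu2 0 R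
  beta_reduce
  rw [gradDot_const_mul_self (hc.differentiable (by norm_num)), gradDot_comp_affine_self hu1,
    lap_const_mul hc, lap_comp_affine hu2]
  simp only [zero_add]
  rw [Real.mul_rpow hA.le (hu.pos _).le]
  linear_combination ((R ^ (4 / (p - 1))) ^ 2 * R ^ 4 *
    (u (R • x) ^ (p - 2) * gradDot u u (R • x) * -lap u (R • x))) * hA1

lemma weighted_gradient_eq_zero (hu : IsStableSolution p u) (hn : n ≤ 8) (hp : 1 < p)
    (x : EuclideanSpace ℝ (Fin n)) : u x ^ (p - 2) * gradDot u u x * -lap u x = 0 := by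
  obtain ⟨C, hC⟩ := exists_weighted_gradient_bound (n := n) hp
  have hp1 : 0 < p - 1 := by linarith
  have hu2 : ContDiff ℝ 2 u := hu.contDiff.of_le (by norm_num)
  set F : EuclideanSpace ℝ (Fin n) → ℝ := fun x => u x ^ (p - 2) * gradDot u u x * -lap u x with hF
  have cF : Continuous F :=
    ((hu.contDiff_rpow (p - 2)).continuous.mul
      (continuous_gradDot (hu2.of_le one_le_two) (hu2.of_le one_le_two))).mul
      (continuous_lap hu2).neg
  have hF0 : ∀ x, 0 ≤ F x := fun x =>
    mul_nonneg (mul_nonneg (Real.rpow_pos_of_pos (hu.pos x) _).le (gradDot_self_nonneg x))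
      (neg_nonneg.2 (hu.lap_nonpos hp x))
  have hFi : ∀ r : ℝ, IntegrableOn F (Metric.closedBall 0 r) := fun r =>
    cF.continuousOn.integrableOn_compact (isCompact_closedBall _ _)
  have hbound : ∀ R : ℝ, 1 ≤ R →
      (R ^ (4 / (p - 1))) ^ 2 * ∫ x in Metric.closedBall 0 R, F x ≤ C := fun R hR => by
    have hR0 : 0 < R := by linarith
    have h1 := hC _ (hu.rescale hp 0 hR0)
    have h2 := fun x => hu.weighted_gradient_rescale hp hR0 x
    simp only at h2
    simp only [h2] at h1
    rw [integral_const_mul, Measure.setIntegral_comp_smul_of_pos volume F _ hR0,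
      finrank_euclideanSpace_fin, smul_closedBall _ _ zero_le_one, smul_zero, mul_one,
      Real.norm_of_nonneg hR0.le, smul_eq_mul] at h1
    refine le_trans ?_ h1
    have h3 : (1 : ℝ) ≤ R ^ 8 * (R ^ n)⁻¹ := by
      rw [← div_eq_mul_inv, one_le_div (by positivity)]
      exact pow_le_pow_right₀ hR hn
    have h4 : 0 ≤ (R ^ (4 / (p - 1))) ^ 2 * ∫ x in Metric.closedBall 0 R, F x :=
      mul_nonneg (sq_nonneg _) (integral_nonneg hF0)
    calc _ ≤ (R ^ 8 * (R ^ n)⁻¹) * ((R ^ (4 / (p - 1))) ^ 2 * ∫ x in Metric.closedBall 0 R, F x) :=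
          le_mul_of_one_le_left h4 h3
      _ = _ := by ring
  by_contra hne
  have hpos : 0 < ∫ y in Metric.closedBall 0 (‖x‖ + 1), F y := by
    rw [setIntegral_pos_iff_support_of_nonneg_ae (.of_forall hF0) (hFi _)]
    refine lt_of_lt_of_le ((cF.isOpen_support.inter Metric.isOpen_ball).measure_pos volume
      ⟨x, hne, ?_⟩) (measure_mono (Set.inter_subset_inter_right _ Metric.ball_subset_closedBall))
    rw [mem_ball_zero_iff]
    linarith
  have hq : 0 < 4 / (p - 1) := by positivity
  have ht : Tendsto (fun R : ℝ => (R ^ (4 / (p - 1))) ^ 2 *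
      ∫ y in Metric.closedBall 0 (‖x‖ + 1), F y) atTop atTop :=
    ((tendsto_pow_atTop two_ne_zero).comp (tendsto_rpow_atTop hq)).atTop_mul_const hpos
  obtain ⟨R, hR, hR1⟩ := ((ht.eventually_gt_atTop C).and
    (eventually_ge_atTop (‖x‖ + 1))).exists
  have h1 := hbound R (by linarith [norm_nonneg x])
  have h2 := setIntegral_mono_set (hFi R) (.of_forall hF0)
    (Metric.closedBall_subset_closedBall hR1).eventuallyLE
  have h3 := mul_le_mul_of_nonneg_left h2 (sq_nonneg (R ^ (4 / (p - 1))))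
  linarith

/-- There is no stable solution of `Δ²u = u^p` in dimension at most `8`. -/
lemma elim (hu : IsStableSolution p u) (hn : n ≤ 8) (hp : 1 < p) : False := by
  have hu2 : ContDiff ℝ 2 u := hu.contDiff.of_le (by norm_num)
  have hlap : ∀ x, lap u x = 0 := fun x => by
    by_contra hne
    have hG : ∀ᶠ y in 𝓝 x, gradDot u u y = 0 := by
      filter_upwards [(continuous_lap hu2).continuousAt.eventually_ne hne] with y hy
      have h := hu.weighted_gradient_eq_zero hn hp y
      simpa [hy, (Real.rpow_pos_of_pos (hu.pos y) (p - 2)).ne'] using h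
    have hpd : ∀ i, partialDeriv i u =ᶠ[𝓝 x] fun _ => 0 := fun i => by
      filter_upwards [hG] with y hy
      have h := (Finset.sum_eq_zero_iff_of_nonneg fun i _ =>
        mul_self_nonneg (partialDeriv i u y)).1 hy i (Finset.mem_univ i)
      exact mul_self_eq_zero.1 h
    refine hne ?_
    rw [lap_eq_sum hu2]
    refine Finset.sum_eq_zero fun i _ => ?_
    rw [partialDeriv_congr (hpd i)]
    simp [partialDeriv]
  have h := hu.lap_lap 0
  rw [show lap u = fun _ => 0 from funext hlap, lap_const] at h
  exact (Real.rpow_pos_of_pos (hu.pos 0) p).ne h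

end IsStableSolution

end Biharmonic

theorem stmt_0 (n : ℕ) (hn1 : 5 ≤ n) (hn2 : n ≤ 8) (p : ℝ) (hp : 1 < p)
    (u : EuclideanSpace ℝ (Fin n) → ℝ) (hreg : ContDiff ℝ 4 u)
    (hpos : ∀ x, 0 < u x)
    (heq : ∀ x, lap (lap u) x = u x ^ p)
    (hstab : ∀ φ : EuclideanSpace ℝ (Fin n) → ℝ, ContDiff ℝ (⊤ : ℕ∞) φ →
      HasCompactSupport φ →
      p * ∫ x, u x ^ (p - 1) * φ x ^ 2 ≤ ∫ x, (lap φ x) ^ 2) :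
    False := by
  exact Biharmonic.IsStableSolution.elim ⟨hreg, hpos, heq, hstab⟩ hn2 hp
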